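/- Let I be a compact interval of ℝ and let f: I → I be an interval map of class C^3 with non-flat critical points that is topologically exact, and let φ: I → ℝ be Hölder continuous. If the Lyapunov exponent of every equilibrium state of f for the potential φ is strictly positive, then the potential φ is hyperbolic for f. -/

import Mathlib

open MeasureTheory Filter Set Metric

noncomputable section

/-- Shannon entropy of the law of a finitely-valued map `p` under the measure `μ`. -/
def partitionEntropy {X ι : Type*} [MeasurableSpace X] [Fintype ι]
    (μ : Measure X) (p : X → ι) : ℝ :=
  ∑ i, Real.negMulLog (μ (p ⁻¹' {i})).toReal

/-- Kolmogorov–Sinai (measure-theoretic) entropy of `f` with respect to `μ`: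
the supremum over finite measurable partitions (coded by maps into `Fin k`) of the
limit (here: infimum, by subadditivity) of the normalized entropies of the joins. -/
def ksEntropy {X : Type*} [MeasurableSpace X] (μ : Measure X) (f : X → X) : ℝ :=
  ⨆ k : ℕ, ⨆ p : { p : X → Fin k // Measurable p },
    ⨅ n : ℕ, partitionEntropy μ (fun x (i : Fin (n + 1)) => p.1 (f^[(i : ℕ)] x)) / (n + 1)

/-- `μ` is an `f`-invariant Borel probability measure giving full mass to `I`. -/
def InvariantProb (f : ℝ → ℝ) (I : Set ℝ) (μ : Measure ℝ) : Prop :=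
  IsProbabilityMeasure μ ∧ μ I = 1 ∧ ∀ A : Set ℝ, MeasurableSet A → μ (f ⁻¹' A) = μ A

/-- Topological pressure of `f : I → I` for the potential `φ`, defined via the
variational principle. -/
def pressure (f : ℝ → ℝ) (I : Set ℝ) (φ : ℝ → ℝ) : ℝ :=
  sSup { r : ℝ | ∃ μ : Measure ℝ, InvariantProb f I μ ∧ r = ksEntropy μ f + ∫ x, φ x ∂μ }

/-- An equilibrium state of `f` for the potential `φ`. -/
def IsEquilibriumState (f : ℝ → ℝ) (I : Set ℝ) (φ : ℝ → ℝ) (μ : Measure ℝ) : Prop :=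
  InvariantProb f I μ ∧ ksEntropy μ f + ∫ x, φ x ∂μ = pressure f I φ

/-- `φ` is Hölder continuous on `I`. -/
def HolderOn (φ : ℝ → ℝ) (I : Set ℝ) : Prop :=
  ∃ C α : ℝ, 0 < α ∧ α ≤ 1 ∧ 0 ≤ C ∧ ∀ x ∈ I, ∀ y ∈ I, |φ x - φ y| ≤ C * |x - y| ^ α

/-- `φ` is hyperbolic for `f`: for some `n ≥ 1`, `sup_I (1/n) Sₙ(φ) < P(f, φ)`. -/
def HyperbolicPotential (f : ℝ → ℝ) (I : Set ℝ) (φ : ℝ → ℝ) : Prop :=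
  ∃ n : ℕ, 1 ≤ n ∧ sSup ((fun x => birkhoffSum f φ n x / n) '' I) < pressure f I φ

/-- `g` is a `C³` diffeomorphism of `ℝ`. -/
def IsC3Diffeo (g : ℝ → ℝ) : Prop :=
  ContDiff ℝ 3 g ∧ Function.Bijective g ∧ ∀ x, deriv g x ≠ 0

/-- `f` is an interval map of class `C³` with non-flat critical points on `I = [a, b]`. -/
structure IsC3NonflatIntervalMap (f : ℝ → ℝ) (a b : ℝ) : Prop where
  lt : a < b
  mapsTo : MapsTo f (Icc a b) (Icc a b)
  diff : ∀ x ∈ Icc a b, DifferentiableAt ℝ f x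
  critFinite : {x | x ∈ Icc a b ∧ deriv f x = 0}.Finite
  smooth : ContDiffOn ℝ 3 f ((Icc a b) \ {x | deriv f x = 0})
  nonflat : ∀ c ∈ Icc a b, deriv f c = 0 →
    ∃ ℓ : ℝ, 1 < ℓ ∧ ∃ φ ψ : ℝ → ℝ, IsC3Diffeo φ ∧ IsC3Diffeo ψ ∧
      φ c = 0 ∧ ψ (f c) = 0 ∧
      ∀ᶠ x in nhdsWithin c (Icc a b), |ψ (f x)| = |φ x| ^ ℓ

/-- `f : I → I` is topologically exact. -/
def TopExact (f : ℝ → ℝ) (I : Set ℝ) : Prop :=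
  ∀ U : Set ℝ, IsOpen U → (U ∩ I).Nonempty → ∃ n : ℕ, 1 ≤ n ∧ f^[n] '' (U ∩ I) = I

section EmpiricalMeasures

variable {X : Type*} [MetricSpace X] [CompactSpace X] [MeasurableSpace X] [BorelSpace X]

/-- Weak limits of asymptotically invariant probability measures are invariant. -/
theorem exists_invariant_limit {T : X → X} (hT : Continuous T)
    (m : ℕ → ProbabilityMeasure X)
    (h : ∀ g : C(X, ℝ),
      Tendsto (fun n => ∫ x, g (T x) ∂(m n : Measure X) - ∫ x, g x ∂(m n : Measure X))
        atTop (nhds 0)) :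
    ∃ μ : ProbabilityMeasure X, MeasurePreserving T (μ : Measure X) μ ∧
      ∃ U : Ultrafilter ℕ, (U : Filter ℕ) ≤ atTop ∧ ∀ g : C(X, ℝ),
        Tendsto (fun n => ∫ x, g x ∂(m n : Measure X)) U (nhds (∫ x, g x ∂(μ : Measure X))) := by
  obtain ⟨μ, hμ⟩ : ∃ μ, Tendsto m (hyperfilter ℕ) (nhds μ) :=
    ⟨_, ((Ultrafilter.map m (hyperfilter ℕ))).le_nhds_lim⟩
  have hU : ((hyperfilter ℕ : Ultrafilter ℕ) : Filter ℕ) ≤ atTop :=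
    Nat.hyperfilter_le_atTop
  have hlim : ∀ g : C(X, ℝ), Tendsto (fun n => ∫ x, g x ∂(m n : Measure X)) (hyperfilter ℕ)
      (nhds (∫ x, g x ∂(μ : Measure X))) := fun g =>
    (ProbabilityMeasure.tendsto_iff_forall_integral_tendsto.1 hμ)
      (BoundedContinuousFunction.mkOfCompact g)
  refine ⟨μ, ⟨hT.measurable, ?_⟩, hyperfilter ℕ, hU, hlim⟩
  have : IsProbabilityMeasure ((μ : Measure X).map T) :=
    Measure.isProbabilityMeasure_map hT.measurable.aemeasurable
  refine ext_of_forall_integral_eq_of_IsFiniteMeasure fun g => ?_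
  rw [integral_map hT.measurable.aemeasurable g.continuous.aestronglyMeasurable]
  have h1 := hlim ⟨fun x => g (T x), g.continuous.comp hT⟩
  have h2 := hlim ⟨g, g.continuous⟩
  exact sub_eq_zero.1 (tendsto_nhds_unique (h1.sub h2) ((h ⟨g, g.continuous⟩).mono_left hU))

/-- The uniform distribution on a finite family of points. -/
def empirical {ι : Type*} [Fintype ι] (x : ι → X) : Measure X :=
  (Fintype.card ι : ENNReal)⁻¹ • ∑ i, Measure.dirac (x i)

instance {ι : Type*} [Fintype ι] [Nonempty ι] (x : ι → X) :
    IsProbabilityMeasure (empirical x) := by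
  constructor
  simp [empirical]
  refine ENNReal.inv_mul_cancel ?_ ?_ <;> simp

theorem integral_empirical {ι : Type*} [Fintype ι] (x : ι → X) (g : C(X, ℝ)) :
    ∫ y, g y ∂(empirical x) = (Fintype.card ι : ℝ)⁻¹ * ∑ i, g (x i) := by
  rw [empirical, integral_smul_measure, integral_finsetSum_measure]
  · simp [integral_dirac]
  · intro i _
    exact integrable_dirac (by simp)

/-- Weak limits of averages of orbit segments of growing length are invariant. -/
theorem exists_invariant_limit_of_orbits {T : X → X} (hT : Continuous T)
    (n : ℕ → ℕ) (hn1 : ∀ j, 1 ≤ n j) (hn : Tendsto n atTop atTop)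
    (ι : ℕ → Type) [∀ j, Fintype (ι j)] [∀ j, Nonempty (ι j)] (x : ∀ j, ι j → X) :
    ∃ μ : ProbabilityMeasure X, MeasurePreserving T (μ : Measure X) μ ∧
      ∃ U : Ultrafilter ℕ, (U : Filter ℕ) ≤ atTop ∧ ∀ g : C(X, ℝ),
        Tendsto (fun j => ((n j : ℝ) * Fintype.card (ι j))⁻¹ *
          ∑ w, ∑ k ∈ Finset.range (n j), g (T^[k] (x j w))) U
          (nhds (∫ x, g x ∂(μ : Measure X))) := by
  have : ∀ j, Nonempty (Fin (n j)) := fun j => ⟨⟨0, hn1 j⟩⟩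
  let m : ℕ → ProbabilityMeasure X := fun j =>
    ⟨empirical (fun p : Fin (n j) × ι j => T^[p.1] (x j p.2)), inferInstance⟩
  have key : ∀ (g : C(X, ℝ)) j, ∫ y, g y ∂(m j : Measure X) =
      ((n j : ℝ) * Fintype.card (ι j))⁻¹ * ∑ w, ∑ k ∈ Finset.range (n j), g (T^[k] (x j w)) := by
    intro g j
    change ∫ y, g y ∂(empirical _) = _
    rw [integral_empirical, Fintype.card_prod, Fintype.card_fin, Nat.cast_mul,
      Fintype.sum_prod_type_right]
    congr 2
    ext w
    rw [Finset.sum_range (fun k => g (T^[k] (x j w)))]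
  obtain ⟨μ, hμ, U, hU, hlim⟩ := exists_invariant_limit hT m (by
    intro g
    have hcard : ∀ j, (0:ℝ) < Fintype.card (ι j) := fun j => by exact_mod_cast Fintype.card_pos
    have hnpos : ∀ j, (0:ℝ) < n j := fun j => by exact_mod_cast hn1 j
    have hb : ∀ j, |∫ x, g (T x) ∂(m j : Measure X) - ∫ x, g x ∂(m j : Measure X)|
        ≤ 2 * ‖g‖ * (n j : ℝ)⁻¹ := by
      intro j
      rw [show (∫ x, g (T x) ∂(m j : Measure X)) =
        ∫ x, (⟨fun x => g (T x), g.continuous.comp hT⟩ : C(X, ℝ)) x ∂(m j : Measure X) from rfl,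
        key, key, ← mul_sub, ← Finset.sum_sub_distrib]
      have : ∀ w, |∑ k ∈ Finset.range (n j), g (T (T^[k] (x j w))) -
          ∑ k ∈ Finset.range (n j), g (T^[k] (x j w))| ≤ 2 * ‖g‖ := by
        intro w
        rw [← Finset.sum_sub_distrib]
        have : ∀ k, g (T (T^[k] (x j w))) = g (T^[k+1] (x j w)) := fun k => by
          rw [Function.iterate_succ_apply']
        simp only [this]
        rw [Finset.sum_range_sub (fun k => g (T^[k] (x j w)))]
        calc _ ≤ |g (T^[n j] (x j w))| + |g (T^[0] (x j w))| := abs_sub _ _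
          _ ≤ ‖g‖ + ‖g‖ := add_le_add (g.norm_coe_le_norm _) (g.norm_coe_le_norm _)
          _ = _ := by ring
      rw [abs_mul, abs_of_pos (inv_pos.2 (mul_pos (hnpos j) (hcard j)))]
      calc _ ≤ ((n j : ℝ) * Fintype.card (ι j))⁻¹ * ∑ w : ι j, 2 * ‖g‖ := by
            refine mul_le_mul_of_nonneg_left ?_
              (inv_pos.2 (mul_pos (hnpos j) (hcard j))).le
            exact (Finset.abs_sum_le_sum_abs _ _).trans (Finset.sum_le_sum fun w _ => this w)
        _ = _ := by
            have := (hcard j).ne'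
            have := (hnpos j).ne'
            simp only [Finset.sum_const, Finset.card_univ, nsmul_eq_mul]
            field_simp
    refine squeeze_zero_norm hb ?_
    have : Tendsto (fun j => ((n j : ℝ))⁻¹) atTop (nhds 0) :=
      (tendsto_inv_atTop_nhds_zero_nat (𝕜 := ℝ)).comp hn
    simpa using this.const_mul (2 * ‖g‖))
  refine ⟨μ, hμ, U, hU, fun g => ?_⟩
  simpa only [key] using hlim g

end EmpiricalMeasures

section EntropyBounds

/-- **Gibbs' inequality** for finite probability vectors. -/
theorem sum_negMulLog_le_of_weight {S : Type*} [Fintype S] (P w : S → ℝ)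
    (hP : ∀ s, 0 ≤ P s) (hP1 : ∑ s, P s = 1) (hw : ∀ s, 0 < w s) (hw1 : ∑ s, w s ≤ 1) :
    ∑ s, Real.negMulLog (P s) ≤ ∑ s, P s * (-Real.log (w s)) := by
  have key : ∀ s, Real.negMulLog (P s) - P s * (-Real.log (w s)) ≤ w s - P s := by
    intro s
    rcases (hP s).eq_or_lt with h | h
    · simp [← h, (hw s).le]
    · have h1 := Real.log_le_sub_one_of_pos (div_pos (hw s) h)
      rw [Real.log_div (hw s).ne' h.ne'] at h1
      have h2 := mul_le_mul_of_nonneg_left h1 h.le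
      have h3 : P s * (w s / P s - 1) = w s - P s := by field_simp
      rw [h3] at h2
      simp only [Real.negMulLog]
      linarith
  have := Finset.sum_le_sum fun s (_ : s ∈ Finset.univ) => key s
  simp only [Finset.sum_sub_distrib] at this
  linarith

/-- If all atoms have mass at most `exp (-h)`, the Shannon entropy is at least `h`. -/
theorem le_sum_negMulLog {S : Type*} [Fintype S] (P : S → ℝ) (h : ℝ)
    (hP : ∀ s, 0 ≤ P s) (hP1 : ∑ s, P s = 1) (hh : ∀ s, P s ≤ Real.exp (-h)) :
    h ≤ ∑ s, Real.negMulLog (P s) := by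
  have key : ∀ s, P s * h ≤ Real.negMulLog (P s) := by
    intro s
    rcases (hP s).eq_or_lt with h0 | h0
    · simp [← h0]
    · have h1 := (Real.log_le_iff_le_exp h0).2 (hh s)
      simp only [Real.negMulLog]
      nlinarith
  calc h = ∑ s, P s * h := by rw [← Finset.sum_mul, hP1, one_mul]
    _ ≤ _ := Finset.sum_le_sum fun s _ => key s

theorem sum_measure_fiber {X S : Type*} [MeasurableSpace X] [Fintype S] [MeasurableSpace S]
    [MeasurableSingletonClass S] (μ : Measure X) [IsProbabilityMeasure μ] {q : X → S}
    (hq : Measurable q) : ∑ s, (μ (q ⁻¹' {s})).toReal = 1 := by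
  have h := sum_measure_preimage_singleton (μ := μ) (f := q) Finset.univ
    (fun s _ => hq (measurableSet_singleton s))
  rw [Finset.coe_univ, preimage_univ, measure_univ] at h
  rw [← ENNReal.toReal_sum (fun s _ => measure_ne_top _ _), h, ENNReal.toReal_one]

theorem sum_fiber_mul_eq_integral {X S : Type*} [MeasurableSpace X] [Fintype S] [MeasurableSpace S]
    [MeasurableSingletonClass S] (μ : Measure X) [IsProbabilityMeasure μ] {q : X → S}
    (hq : Measurable q) (F : S → ℝ) :
    ∑ s, (μ (q ⁻¹' {s})).toReal * F s = ∫ x, F (q x) ∂μ := by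
  have : IsProbabilityMeasure (μ.map q) := Measure.isProbabilityMeasure_map hq.aemeasurable
  rw [← integral_map (φ := q) (f := F) hq.aemeasurable
    (measurable_of_finite F).aestronglyMeasurable, integral_fintype .of_finite]
  refine Finset.sum_congr rfl fun s _ => ?_
  rw [smul_eq_mul, measureReal_def, Measure.map_apply hq (measurableSet_singleton s)]

theorem exists_continuous_approx_of_measurable {X : Type*} [MetricSpace X] [CompactSpace X]
    [MeasurableSpace X] [BorelSpace X] (μ : Measure X) [IsProbabilityMeasure μ]
    {p : X → ℝ} (hp : Measurable p) (hb : ∃ C, ∀ x, ‖p x‖ ≤ C) {ε : ℝ} (hε : 0 < ε) :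
    ∃ g : C(X, ℝ), (μ {x | 1 / 4 ≤ |g x - p x|}).toReal ≤ ε := by
  obtain ⟨C, hC⟩ := hb
  have hi : Integrable p μ := Integrable.of_bound hp.aestronglyMeasurable C (ae_of_all _ hC)
  obtain ⟨g, hg, hgi⟩ := hi.exists_boundedContinuous_integral_sub_le (ε := ε / 4) (by positivity)
  refine ⟨g.toContinuousMap, ?_⟩
  have h := mul_meas_ge_le_integral_of_nonneg (μ := μ) (f := fun x => ‖p x - g x‖)
    (ae_of_all _ fun x => norm_nonneg _) (hi.sub hgi).norm (1 / 4)
  have h2 : {x | 1 / 4 ≤ |g.toContinuousMap x - p x|} = {x | 1 / 4 ≤ ‖p x - g x‖} := by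
    ext x
    simp [abs_sub_comm (p x)]
  rw [h2]
  rw [measureReal_def] at h
  linarith

/-- Entropy bound for a map whose orbit segments of length `n` can be shadowed by at most
`C * L ^ n` reference segments. -/
theorem iInf_partitionEntropy_le {X : Type*} [MetricSpace X] [CompactSpace X]
    [MeasurableSpace X] [BorelSpace X] (μ : Measure X) [IsProbabilityMeasure μ]
    {T : X → X} (hT : MeasurePreserving T μ μ) {L : ℝ} (hL : 1 ≤ L)
    (hcov : ∀ η > 0, ∃ C : ℝ, 1 ≤ C ∧ ∀ n : ℕ, ∃ R : Finset X, (R.card : ℝ) ≤ C * L ^ n ∧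
      ∀ x, ∃ r ∈ R, ∀ i < n, dist (T^[i] x) (T^[i] r) ≤ η)
    {k : ℕ} {p : X → Fin k} (hp : Measurable p) :
    ⨅ n : ℕ, partitionEntropy μ (fun x (i : Fin (n + 1)) => p (T^[(i : ℕ)] x)) / (n + 1)
      ≤ Real.log L + Real.log 2 + 1 := by
  classical
  have : Nonempty X := by
    by_contra h
    rw [not_nonempty_iff] at h
    have := measure_univ (μ := μ)
    rw [univ_eq_empty_iff.2 h, measure_empty] at this
    exact zero_ne_one this
  have : Nonempty (Fin k) := ⟨p (Classical.arbitrary X)⟩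
  have hk1 : 1 ≤ k := Fin.pos_iff_nonempty.2 this
  have hkpos : (0:ℝ) < k := by exact_mod_cast hk1
  have hlogk : 0 ≤ Real.log k := Real.log_natCast_nonneg k
  obtain ⟨g, hg⟩ := exists_continuous_approx_of_measurable μ (p := fun x => ((p x : ℕ) : ℝ))
    ((measurable_of_finite (fun a : Fin k => ((a : ℕ) : ℝ))).comp hp)
    ⟨k, fun x => by simp [(p x).2.le]⟩ (ε := 1 / (Real.log k + 1)) (by positivity)
  set bad : Set X := {x | 1 / 4 ≤ |g x - ((p x : ℕ) : ℝ)|} with hbad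
  have hbadm : MeasurableSet bad :=
    measurableSet_le measurable_const
      ((g.continuous.measurable.sub
        ((measurable_of_finite (fun a : Fin k => ((a : ℕ) : ℝ))).comp hp)).abs)
  have huc := CompactSpace.uniformContinuous_of_continuous g.continuous
  obtain ⟨η', hη', hgη'⟩ := Metric.uniformContinuous_iff.1 huc (1 / 4) (by norm_num)
  obtain ⟨C, hC1, hC⟩ := hcov (η' / 2) (by positivity)
  let Q : X → Fin k := fun y =>
    if h : ∃ a : Fin k, |g y - ((a : ℕ) : ℝ)| < 1 / 2 then h.choose else Classical.arbitrary _
  have hQ : ∀ y y', y ∉ bad → dist y y' ≤ η' / 2 → p y = Q y' := by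
    intro y y' hy hd
    have h1 : |g y - ((p y : ℕ) : ℝ)| < 1 / 4 := by simpa [hbad] using hy
    have h2 := hgη' (show dist y y' < η' by linarith)
    rw [Real.dist_eq] at h2
    have h3 : |g y' - ((p y : ℕ) : ℝ)| < 1 / 2 := by
      rw [abs_lt] at *; constructor <;> linarith
    have hex : ∃ a : Fin k, |g y' - ((a : ℕ) : ℝ)| < 1 / 2 := ⟨p y, h3⟩
    have h4 : |g y' - ((Q y' : ℕ) : ℝ)| < 1 / 2 := by
      simp only [Q, dif_pos hex]; exact hex.choose_spec
    have h5 : |((p y : ℕ) : ℝ) - ((Q y' : ℕ) : ℝ)| < 1 := by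
      rw [abs_lt] at *; constructor <;> linarith
    have h6 : |((p y : ℕ) : ℤ) - ((Q y' : ℕ) : ℤ)| < 1 := by exact_mod_cast h5
    rw [Int.abs_lt_one_iff] at h6
    exact Fin.ext (by omega)
  let v : Fin k → Fin k → ℝ := fun a c => if a = c then 1 / 2 + 1 / (2 * k) else 1 / (2 * k)
  have hvpos : ∀ a c, 0 < v a c := fun a c => by
    simp only [v]; split_ifs <;> positivity
  have hvsum : ∀ c, ∑ a, v a c = 1 := by
    intro c
    have : ∀ a, v a c = (if a = c then 1 / 2 else 0) + 1 / (2 * (k:ℝ)) := by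
      intro a; simp only [v]; split_ifs <;> simp
    simp only [this, Finset.sum_add_distrib, Finset.sum_ite_eq', Finset.mem_univ, if_true,
      Finset.sum_const, Finset.card_univ, Fintype.card_fin, nsmul_eq_mul]
    field_simp; norm_num
  have hiter : ∀ i, Measurable (T^[i]) := fun i => hT.measurable.iterate i
  have bound : ∀ n : ℕ, partitionEntropy μ (fun x (i : Fin (n + 1)) => p (T^[(i : ℕ)] x)) ≤
      (Real.log C + Real.log L * (n + 1)) + (n + 1) * (Real.log 2 + 1) := by
    intro n
    obtain ⟨R, hR, hRx⟩ := hC (n + 1)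
    have hRne : R.Nonempty := by
      obtain ⟨r, hr, -⟩ := hRx (Classical.arbitrary X)
      exact ⟨r, hr⟩
    have hRpos : (0:ℝ) < R.card := by exact_mod_cast hRne.card_pos
    let w : (Fin (n + 1) → Fin k) → ℝ := fun s =>
      (R.card : ℝ)⁻¹ * ∑ r ∈ R, ∏ i, v (s i) (Q (T^[(i:ℕ)] r))
    have hprodpos : ∀ (s : Fin (n + 1) → Fin k) (r : X),
        0 < ∏ i : Fin (n + 1), v (s i) (Q (T^[(i:ℕ)] r)) := fun s r =>
      Finset.prod_pos fun i _ => hvpos _ _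
    have hw : ∀ s, 0 < w s := fun s =>
      mul_pos (inv_pos.2 hRpos) (Finset.sum_pos (fun r _ => hprodpos s r) hRne)
    have hw1 : ∑ s, w s ≤ 1 := by
      simp only [w]
      rw [← Finset.mul_sum, Finset.sum_comm]
      have : ∀ r ∈ R, ∑ s : Fin (n + 1) → Fin k, ∏ i, v (s i) (Q (T^[(i:ℕ)] r)) = 1 := by
        intro r _
        have h := Finset.prod_univ_sum (fun _ : Fin (n + 1) => (Finset.univ : Finset (Fin k)))
          (fun i a => v a (Q (T^[(i:ℕ)] r)))
        rw [Fintype.piFinset_univ] at h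
        rw [← h]
        simp [hvsum]
      rw [Finset.sum_congr rfl this]
      simp [hRpos.ne']
    have hqm : Measurable (fun x (i : Fin (n + 1)) => p (T^[(i : ℕ)] x)) :=
      measurable_pi_lambda _ fun i => hp.comp (hiter i)
    have h1 := sum_negMulLog_le_of_weight
      (fun s => (μ ((fun x (i : Fin (n + 1)) => p (T^[(i : ℕ)] x)) ⁻¹' {s})).toReal) w
      (fun s => ENNReal.toReal_nonneg) (sum_measure_fiber μ hqm) hw hw1
    rw [sum_fiber_mul_eq_integral μ hqm (fun s => -Real.log (w s))] at h1
    have hptw : ∀ x, -Real.log (w (fun i => p (T^[(i:ℕ)] x))) ≤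
        (Real.log C + Real.log L * (n + 1)) + ∑ i : Fin (n + 1),
          (Real.log 2 + bad.indicator (fun _ => Real.log k) (T^[(i:ℕ)] x)) := by
      intro x
      obtain ⟨r, hr, hrx⟩ := hRx x
      have hv : ∀ i : Fin (n + 1),
          -(Real.log 2 + bad.indicator (fun _ => Real.log k) (T^[(i:ℕ)] x)) ≤
          Real.log (v (p (T^[(i:ℕ)] x)) (Q (T^[(i:ℕ)] r))) := by
        intro i
        by_cases hb : T^[(i:ℕ)] x ∈ bad
        · rw [indicator_of_mem hb, ← Real.log_mul (by norm_num) hkpos.ne', ← Real.log_inv]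
          apply Real.log_le_log (by positivity)
          simp only [v]
          split_ifs
          · rw [one_div (2 * (k:ℝ))]; linarith
          · rw [one_div]
        · rw [indicator_of_notMem hb, add_zero, ← Real.log_inv]
          apply Real.log_le_log (by positivity)
          rw [hQ _ _ hb (hrx i i.2)]
          simp only [v, if_true]
          have : 0 < 1 / (2 * (k:ℝ)) := by positivity
          linarith
      have hlow : (R.card : ℝ)⁻¹ * ∏ i : Fin (n + 1), v (p (T^[(i:ℕ)] x)) (Q (T^[(i:ℕ)] r)) ≤
          w (fun i => p (T^[(i:ℕ)] x)) :=
        mul_le_mul_of_nonneg_left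
          (Finset.single_le_sum (f := fun r => ∏ i : Fin (n + 1),
            v (p (T^[(i:ℕ)] x)) (Q (T^[(i:ℕ)] r))) (fun r _ => (hprodpos _ r).le) hr)
          (inv_pos.2 hRpos).le
      have hlog := Real.log_le_log (mul_pos (inv_pos.2 hRpos) (hprodpos _ r)) hlow
      rw [Real.log_mul (inv_pos.2 hRpos).ne' (hprodpos _ r).ne', Real.log_inv,
        Real.log_prod (fun i _ => (hvpos _ _).ne')] at hlog
      have hlR : Real.log R.card ≤ Real.log C + Real.log L * (n + 1) := by
        have := Real.log_le_log hRpos hR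
        rw [Real.log_mul (by positivity) (by positivity), Real.log_pow] at this
        push_cast at this
        linarith
      have hs := Finset.sum_le_sum fun i (_ : i ∈ Finset.univ) => hv i
      rw [Finset.sum_neg_distrib] at hs
      linarith
    have hind : ∀ i : ℕ,
        Integrable (fun x => bad.indicator (fun _ => Real.log k) (T^[i] x)) μ := fun i =>
      (hT.iterate i).integrable_comp_of_integrable ((integrable_const _).indicator hbadm)
    have hI : ∀ i : Fin (n + 1), Integrable (fun x =>
        (Real.log 2 + bad.indicator (fun _ => Real.log k) (T^[(i:ℕ)] x))) μ := fun i =>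
      (integrable_const _).add (hind i)
    have hcost : ∀ i : Fin (n + 1), ∫ x, (Real.log 2 +
        bad.indicator (fun _ => Real.log k) (T^[(i:ℕ)] x)) ∂μ ≤ Real.log 2 + 1 := by
      intro i
      rw [integral_add (integrable_const _) (hind i)]
      have e : ∫ x, bad.indicator (fun _ => Real.log k) (T^[(i:ℕ)] x) ∂μ =
          (μ bad).toReal * Real.log k := by
        have := (hT.iterate i).map_eq
        rw [← integral_map (f := bad.indicator (fun _ => Real.log (k:ℝ)))
          (hiter i).aemeasurable
          ((measurable_const.indicator hbadm).aestronglyMeasurable), this,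
          integral_indicator_const _ hbadm, smul_eq_mul, measureReal_def]
      rw [e]
      have : (μ bad).toReal * Real.log k ≤ 1 := by
        calc _ ≤ 1 / (Real.log k + 1) * Real.log k := mul_le_mul_of_nonneg_right hg hlogk
          _ ≤ 1 := by
            rw [one_div_mul_eq_div, div_le_one (by positivity)]; linarith
      simp; linarith
    calc _ ≤ _ := h1
      _ ≤ ∫ x, ((Real.log C + Real.log L * (n + 1)) + ∑ i : Fin (n + 1),
          (Real.log 2 + bad.indicator (fun _ => Real.log k) (T^[(i:ℕ)] x))) ∂μ := by
          refine integral_mono ?_ ?_ hptw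
          · exact Integrable.of_finite.comp_measurable (μ := μ)
              (g := fun s => -Real.log (w s)) hqm
          · exact (integrable_const _).add (integrable_finsetSum _ fun i _ => hI i)
      _ = (Real.log C + Real.log L * (n + 1)) + ∑ i : Fin (n + 1), ∫ x,
          (Real.log 2 + bad.indicator (fun _ => Real.log k) (T^[(i:ℕ)] x)) ∂μ := by
          rw [integral_add (integrable_const _) (integrable_finsetSum _ fun i _ => hI i),
            integral_finsetSum _ fun i _ => hI i]
          simp
      _ ≤ _ := by
          have := Finset.sum_le_sum fun i (_ : i ∈ Finset.univ) => hcost i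
          simp only [Finset.sum_const, Finset.card_univ, Fintype.card_fin, nsmul_eq_mul,
            Nat.cast_add, Nat.cast_one] at this
          linarith
  have hnn : ∀ n : ℕ, 0 ≤
      partitionEntropy μ (fun x (i : Fin (n + 1)) => p (T^[(i : ℕ)] x)) / (n + 1) := by
    intro n
    refine div_nonneg (Finset.sum_nonneg fun s _ => Real.negMulLog_nonneg
      ENNReal.toReal_nonneg ?_) (by positivity)
    exact ENNReal.toReal_le_of_le_ofReal zero_le_one (by simpa using prob_le_one)
  have hlim : Tendsto (fun n : ℕ => Real.log C * (1 / ((n : ℝ) + 1)) +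
      (Real.log L + Real.log 2 + 1)) atTop (nhds (Real.log C * 0 + (Real.log L + Real.log 2 + 1))) :=
    (tendsto_one_div_add_atTop_nhds_zero_nat.const_mul _).add_const _
  rw [mul_zero, zero_add] at hlim
  refine ge_of_tendsto' hlim fun n => ?_
  refine (ciInf_le ⟨0, by rintro _ ⟨n, rfl⟩; exact hnn n⟩ n).trans ?_
  rw [div_le_iff₀ (by positivity)]
  refine (bound n).trans (le_of_eq ?_)
  field_simp
  ring

end EntropyBounds

section Horseshoe

theorem sum_words_prod_ite {L m : ℕ} (hm : 1 ≤ m) (B : Finset ℕ) (hB : ∀ l ∈ B, l < L)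
    (s : ℕ → Fin m) (ext : (Fin L → Fin m) → ℕ → Fin m) (hext : ∀ w (l : Fin L), ext w l = w l) :
    ∑ w, ∏ l ∈ B, (if ext w l = s l then (1:ℝ) else 0) = (m:ℝ) ^ L * ((m:ℝ)⁻¹) ^ B.card := by
  have hm0 : (m:ℝ) ≠ 0 := by positivity
  have hBL : (Finset.range L).filter (· ∈ B) = B := by
    ext l; simp only [Finset.mem_filter, Finset.mem_range]
    exact ⟨fun h => h.2, fun h => ⟨hB l h, h⟩⟩
  have h1 : ∀ F : ℕ → ℝ, ∏ l ∈ B, F l = ∏ l : Fin L, (if (l:ℕ) ∈ B then F l else 1) := by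
    intro F
    rw [← Finset.prod_range (fun l => if l ∈ B then F l else 1), ← Finset.prod_filter, hBL]
  have h2 : ∀ w : Fin L → Fin m, ∏ l ∈ B, (if ext w l = s l then (1:ℝ) else 0) =
      ∏ l : Fin L, (if (l:ℕ) ∈ B then (if w l = s l then (1:ℝ) else 0) else 1) := by
    intro w
    rw [h1]
    simp only [hext]
  simp only [h2]
  have h3 := Finset.prod_univ_sum (fun _ : Fin L => (Finset.univ : Finset (Fin m)))
    (fun l a => if (l:ℕ) ∈ B then (if a = s l then (1:ℝ) else 0) else 1)
  rw [Fintype.piFinset_univ] at h3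
  rw [← h3]
  have h4 : ∀ l : Fin L, ∑ a : Fin m, (if (l:ℕ) ∈ B then (if a = s l then (1:ℝ) else 0) else 1) =
      (m:ℝ) * (if (l:ℕ) ∈ B then (m:ℝ)⁻¹ else 1) := by
    intro l
    split_ifs
    · simp [hm0]
    · simp
  simp only [h4, Finset.prod_mul_distrib]
  rw [← h1 (fun _ => (m:ℝ)⁻¹)]
  simp

theorem exists_point_of_word {X : Type*} {F : X → X} {m : ℕ} {J : Fin m → Set X} [Nonempty X]
    (hJ : ∀ w, ∀ z, ∃ y ∈ J w, F y = z) (n : ℕ) (w : ℕ → Fin m) :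
    ∃ x, ∀ k < n, F^[k] x ∈ J (w k) := by
  induction n generalizing w with
  | zero => exact ⟨Classical.arbitrary X, by simp⟩
  | succ n ih =>
    obtain ⟨x', hx'⟩ := ih (fun k => w (k + 1))
    obtain ⟨y, hy, rfl⟩ := hJ (w 0) x'
    refine ⟨y, fun k hk => ?_⟩
    cases k with
    | zero => exact hy
    | succ k =>
      rw [Function.iterate_succ_apply]
      exact hx' k (by omega)

variable {X : Type*} [MetricSpace X] [CompactSpace X] [MeasurableSpace X] [BorelSpace X]

/-- A full horseshoe with `m` disjoint closed branches carries an invariant measure for which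
prescribing `k` symbols has probability at most `m⁻ᵏ`. -/
theorem exists_bernoulli_type_measure [Nonempty X] {F : X → X} (hF : Continuous F) {m : ℕ}
    (hm : 1 ≤ m)
    {J : Fin m → Set X} (hJc : ∀ w, IsClosed (J w)) (hJd : Pairwise fun v w => Disjoint (J v) (J w))
    (hJ : ∀ w, ∀ z, ∃ y ∈ J w, F y = z) :
    ∃ μ : Measure X, IsProbabilityMeasure μ ∧ MeasurePreserving F μ μ ∧
      (∀ᵐ y ∂μ, y ∈ ⋃ w, J w) ∧
      ∀ (A : Finset ℕ) (s : ℕ → Fin m),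
        (μ (⋂ i ∈ A, F^[i] ⁻¹' J (s i))).toReal ≤ ((m:ℝ)⁻¹) ^ A.card := by
  have : Nonempty (Fin m) := ⟨⟨0, hm⟩⟩
  let ext : ∀ L, (Fin L → Fin m) → ℕ → Fin m := fun L w l =>
    if h : l < L then w ⟨l, h⟩ else Classical.arbitrary _
  have hext : ∀ L w (l : Fin L), ext L w l = w l := fun L w l => by simp [ext]
  choose pt hpt using fun (L : ℕ) (w : Fin L → Fin m) => exists_point_of_word hJ L (ext L w)
  obtain ⟨μ, hμ, U, hU, hlim⟩ := exists_invariant_limit_of_orbits hF (fun j => j + 1)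
    (fun j => Nat.le_add_left 1 j) (tendsto_add_atTop_nat 1)
    (fun j => Fin (2 * (j + 1)) → Fin m) (fun j w => pt _ w)
  refine ⟨μ, inferInstance, hμ, ?_, ?_⟩
  · set K := ⋃ w, J w with hK
    have hKc : IsClosed K := isClosed_iUnion_of_finite hJc
    have hKn : K.Nonempty := by
      obtain ⟨y, hy, -⟩ := hJ (Classical.arbitrary _) (Classical.arbitrary X)
      exact ⟨y, mem_iUnion.2 ⟨_, hy⟩⟩
    have h0 : ∫ x, infDist x K ∂(μ : Measure X) = 0 := by
      refine tendsto_nhds_unique (hlim ⟨fun x => infDist x K, continuous_infDist_pt K⟩) ?_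
      refine tendsto_const_nhds.congr fun j => ?_
      symm
      refine mul_eq_zero_of_right _ (Finset.sum_eq_zero fun w _ => Finset.sum_eq_zero fun k hk => ?_)
      refine infDist_zero_of_mem (mem_iUnion.2 ⟨_, hpt _ w k ?_⟩)
      have := Finset.mem_range.1 hk
      omega
    rw [integral_eq_zero_iff_of_nonneg (fun x => infDist_nonneg)
      ((continuous_infDist_pt K).integrable_of_hasCompactSupport
        (HasCompactSupport.of_compactSpace _))] at h0
    filter_upwards [h0] with x hx
    exact (hKc.mem_iff_infDist_zero hKn).2 hx
  · intro A s
    have hg : ∀ a : Fin m, ∃ g : C(X, ℝ), EqOn g 0 (⋃ b ∈ {b | b ≠ a}, J b) ∧ EqOn g 1 (J a) ∧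
        ∀ x, g x ∈ Icc (0:ℝ) 1 := by
      intro a
      refine exists_continuous_zero_one_of_isClosed
        ((toFinite {b | b ≠ a}).isClosed_biUnion fun b _ => hJc b) (hJc a) ?_
      rw [disjoint_iUnion₂_left]
      exact fun b hb => hJd hb
    choose g hg0 hg1 hg01 using hg
    let G : C(X, ℝ) := ⟨fun x => ∏ i ∈ A, g (s i) (F^[i] x),
      continuous_finsetProd _ fun i _ => (g (s i)).continuous.comp (hF.iterate i)⟩
    have hG : ∫ x, G x ∂(μ : Measure X) = ((m:ℝ)⁻¹) ^ A.card := by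
      refine tendsto_nhds_unique (hlim G) ?_
      obtain ⟨a0, ha0⟩ : ∃ a0, ∀ i ∈ A, i ≤ a0 := ⟨A.sup id, fun i hi => Finset.le_sup (f := id) hi⟩
      refine tendsto_const_nhds.congr' ?_
      filter_upwards [hU (eventually_ge_atTop a0)] with j hj
      have hval : ∀ k < j + 1, ∑ w, G (F^[k] (pt (2 * (j + 1)) w)) =
          (m:ℝ) ^ (2 * (j + 1)) * ((m:ℝ)⁻¹) ^ A.card := by
        intro k hk
        have hinj : Function.Injective (fun i : ℕ => k + i) := fun a b h => by simpa using h
        rw [← Finset.card_image_of_injective A hinj,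
          ← sum_words_prod_ite hm (A.image fun i => k + i) (by
            intro l hl
            obtain ⟨i, hi, rfl⟩ := Finset.mem_image.1 hl
            have := ha0 i hi
            omega) (fun l => s (l - k)) (ext (2 * (j + 1))) (hext _)]
        refine Finset.sum_congr rfl fun w _ => ?_
        rw [Finset.prod_image (fun a _ b _ h => hinj h)]
        refine Finset.prod_congr rfl fun i hi => ?_
        have hmem : F^[k + i] (pt (2 * (j + 1)) w) ∈ J (ext _ w (k + i)) := hpt _ w _ (by
          have := ha0 i hi
          omega)
        rw [← Function.iterate_add_apply, add_comm i k, Nat.add_sub_cancel_left]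
        split_ifs with h
        · rw [h] at hmem
          exact hg1 _ hmem
        · exact hg0 (s i) (mem_iUnion₂.2 ⟨_, h, hmem⟩)
      rw [Finset.sum_comm, Finset.sum_congr rfl (fun k hk => hval k (Finset.mem_range.1 hk))]
      have hm0 : (m:ℝ) ≠ 0 := by positivity
      have hj0 : ((j + 1 : ℕ) : ℝ) ≠ 0 := by positivity
      rw [Finset.sum_const, Finset.card_range, nsmul_eq_mul, Fintype.card_fun, Fintype.card_fin,
        Fintype.card_fin, Nat.cast_pow]
      field_simp
    rw [← hG]
    have hmeas : MeasurableSet (⋂ i ∈ A, F^[i] ⁻¹' J (s i)) :=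
      (isClosed_biInter fun i _ => (hJc _).preimage (hF.iterate i)).measurableSet
    rw [← measureReal_def, ← integral_indicator_one hmeas]
    refine integral_mono ((integrable_const _).indicator hmeas)
      (G.continuous.integrable_of_hasCompactSupport (HasCompactSupport.of_compactSpace _)) ?_
    intro x
    by_cases hx : x ∈ ⋂ i ∈ A, F^[i] ⁻¹' J (s i)
    · rw [indicator_of_mem hx]
      refine (Finset.prod_eq_one fun i hi => ?_).ge
      exact hg1 _ (mem_iInter₂.1 hx i hi)
    · rw [indicator_of_notMem hx]
      exact Finset.prod_nonneg fun i _ => (hg01 _ _).1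

theorem le_sum_card_multiples {N : ℕ} (hN : 1 ≤ N) (n : ℕ) :
    n ≤ ∑ j ∈ Finset.range N,
      ((Finset.range (j + n)).filter fun k => j ≤ k * N ∧ k * N < j + n).card := by
  rw [← Finset.card_sigma]
  conv_lhs => rw [← Finset.card_range n]
  have hdiv : ∀ i : ℕ, ∃ j k : ℕ, j < N ∧ i + j = k * N := by
    intro i
    refine ⟨(N - i % N) % N, (i + (N - i % N) % N) / N, Nat.mod_lt _ hN, ?_⟩
    rw [Nat.div_mul_cancel]
    rw [Nat.dvd_iff_mod_eq_zero, Nat.add_mod, Nat.mod_mod, ← Nat.add_mod,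
      Nat.add_mod]
    have h1 := Nat.mod_lt i hN
    rcases Nat.eq_zero_or_pos (i % N) with h | h
    · rw [h]; simp
    · rw [Nat.mod_eq_of_lt (show N - i % N < N by omega), show i % N + (N - i % N) = N by omega,
        Nat.mod_self]
  choose jf kf hj hk using hdiv
  refine Finset.card_le_card_of_injOn (fun i => (⟨jf i, kf i⟩ : Σ _ : ℕ, ℕ)) ?_ ?_
  · intro i hi
    have hi' := Finset.mem_range.1 hi
    have h1 := hj i
    have h2 := hk i
    simp only [Finset.coe_sigma, mem_sigma_iff, Finset.mem_coe, Finset.mem_range,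
      Finset.mem_filter]
    have h3 : kf i ≤ kf i * N := Nat.le_mul_of_pos_right _ hN
    refine ⟨h1, ?_, ?_, ?_⟩ <;> omega
  · intro i _ i' _ h
    simp only [Sigma.mk.injEq, heq_eq_eq] at h
    have h1 := hk i
    have h2 := hk i'
    rw [← h.1, ← h.2] at h2
    omega

end Horseshoe

section HorseshoeMeasure

theorem le_sum_negMulLog_average {S : Type*} [Fintype S] {N : ℕ} (hN : 1 ≤ N)
    (P : ℕ → S → ℝ) (hP : ∀ j s, 0 ≤ P j s) (h : ℕ → ℝ)
    (hh : ∀ j < N, h j ≤ ∑ s, Real.negMulLog (P j s)) :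
    (N:ℝ)⁻¹ * ∑ j ∈ Finset.range N, h j ≤
      ∑ s, Real.negMulLog ((N:ℝ)⁻¹ * ∑ j ∈ Finset.range N, P j s) := by
  have hNpos : (0:ℝ) < N := by exact_mod_cast hN
  have hs : ∀ s, (N:ℝ)⁻¹ * ∑ j ∈ Finset.range N, Real.negMulLog (P j s) ≤
      Real.negMulLog ((N:ℝ)⁻¹ * ∑ j ∈ Finset.range N, P j s) := by
    intro s
    have := Real.concaveOn_negMulLog.le_map_sum (t := Finset.range N) (w := fun _ => (N:ℝ)⁻¹)
      (p := fun j => P j s) (fun _ _ => by positivity) (by simp [hNpos.ne']) (fun j _ => hP j s)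
    simpa [Finset.mul_sum] using this
  refine le_trans ?_ (Finset.sum_le_sum fun s _ => hs s)
  rw [← Finset.mul_sum, Finset.sum_comm]
  exact mul_le_mul_of_nonneg_left
    (Finset.sum_le_sum fun j hj => hh j (Finset.mem_range.1 hj)) (by positivity)

variable {X : Type*} [MetricSpace X] [CompactSpace X] [MeasurableSpace X] [BorelSpace X]

/-- A full horseshoe for `T^[N]` with `m` branches on each of which the Birkhoff sums of `φ` are
at least `β` carries a `T`-invariant measure with entropy at least `log m / N` and
`φ`-integral at least `β / N`. -/
theorem exists_measure_of_horseshoe [Nonempty X] {T : X → X} (hT : Continuous T)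
    {N m : ℕ} (hN : 1 ≤ N) (hm : 1 ≤ m)
    {J : Fin m → Set X} (hJc : ∀ w, IsClosed (J w)) (hJd : Pairwise fun v w => Disjoint (J v) (J w))
    (hJ : ∀ w, ∀ z, ∃ y ∈ J w, T^[N] y = z) (φ : C(X, ℝ)) (β : ℝ)
    (hβ : ∀ w, ∀ y ∈ J w, β ≤ birkhoffSum T φ N y) :
    ∃ μ : Measure X, IsProbabilityMeasure μ ∧ MeasurePreserving T μ μ ∧
      (∃ q : X → Fin m, Measurable q ∧ ∀ n : ℕ, (n + 1) * (Real.log m / N) ≤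
        partitionEntropy μ (fun x (i : Fin (n + 1)) => q (T^[(i:ℕ)] x))) ∧
      β / N ≤ ∫ x, φ x ∂μ := by
  classical
  obtain ⟨μ₀, hp, hinv, hK, hA⟩ := exists_bernoulli_type_measure (hT.iterate N) hm hJc hJd hJ
  have hNpos : (0:ℝ) < N := by exact_mod_cast hN
  have hmpos : (0:ℝ) < m := by exact_mod_cast hm
  have hTm : ∀ j, Measurable T^[j] := fun j => (hT.iterate j).measurable
  set μ : Measure X := (N:ENNReal)⁻¹ • ∑ j ∈ Finset.range N, μ₀.map T^[j] with hμ
  have hμprob : IsProbabilityMeasure μ := by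
    constructor
    simp only [hμ, Measure.smul_apply, Measure.finsetSum_apply, smul_eq_mul]
    have : ∀ j ∈ Finset.range N, (μ₀.map T^[j]) univ = 1 := fun j _ => by
      rw [Measure.map_apply (hTm j) MeasurableSet.univ, preimage_univ, measure_univ]
    rw [Finset.sum_congr rfl this]
    simp only [Finset.sum_const, Finset.card_range, nsmul_eq_mul, mul_one]
    refine ENNReal.inv_mul_cancel ?_ ?_ <;> simp; omega
  have hmeas : ∀ B, MeasurableSet B → (μ B).toReal =
      (N:ℝ)⁻¹ * ∑ j ∈ Finset.range N, (μ₀ (T^[j] ⁻¹' B)).toReal := by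
    intro B hB
    simp only [hμ, Measure.smul_apply, Measure.finsetSum_apply, smul_eq_mul, ENNReal.toReal_mul,
      ENNReal.toReal_inv, ENNReal.toReal_natCast]
    rw [ENNReal.toReal_sum (fun j _ => by
      rw [Measure.map_apply (hTm j) hB]; exact measure_ne_top _ _)]
    simp only [Measure.map_apply (hTm _) hB]
  have hTinv : MeasurePreserving T μ μ := by
    refine ⟨hT.measurable, ?_⟩
    have e1 : ∀ j, (μ₀.map T^[j]).map T = μ₀.map T^[j + 1] := fun j => by
      rw [Measure.map_map hT.measurable (hTm j), ← Function.iterate_succ']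
    rw [hμ, Measure.map_smul, ← Measure.mapₗ_apply_of_measurable hT.measurable, map_sum]
    simp only [Measure.mapₗ_apply_of_measurable hT.measurable, e1]
    congr 1
    have h1 := Finset.sum_range_succ (fun j => μ₀.map T^[j]) N
    have h2 := Finset.sum_range_succ' (fun j => μ₀.map T^[j]) N
    rw [hinv.map_eq] at h1
    rw [h1] at h2
    simp only [Function.iterate_zero, Measure.map_id] at h2
    have h3 : ∀ ν ν' : Measure X, ν + μ₀ = ν' + μ₀ → ν = ν' := fun ν ν' h => by
      ext B hB
      have := congrArg (fun κ : Measure X => κ B) h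
      simp only [Measure.add_apply] at this
      exact (ENNReal.add_left_inj (measure_ne_top μ₀ B)).1 this
    exact (h3 _ _ h2).symm
  refine ⟨μ, hμprob, hTinv, ?_, ?_⟩
  · have : Nonempty (Fin m) := ⟨⟨0, hm⟩⟩
    let q : X → Fin m := fun y => if h : ∃ a, y ∈ J a then h.choose else Classical.arbitrary _
    have hq : ∀ y, y ∈ ⋃ w, J w → y ∈ J (q y) := by
      intro y hy
      have h : ∃ a, y ∈ J a := mem_iUnion.1 hy
      simp only [q, dif_pos h]
      exact h.choose_spec
    have hq' : ∀ y a, y ∈ J a → q y = a := by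
      intro y a hy
      by_contra hne
      exact disjoint_left.1 (hJd hne) (hq y (mem_iUnion.2 ⟨a, hy⟩)) hy
    have hKm : MeasurableSet (⋃ w, J w) := (isClosed_iUnion_of_finite hJc).measurableSet
    have hqm : Measurable q := by
      refine measurable_to_countable' fun a => ?_
      have : q ⁻¹' {a} = J a ∪ ((⋃ w, J w)ᶜ ∩ {_y | a = Classical.arbitrary (Fin m)}) := by
        ext y
        simp only [mem_preimage, mem_singleton_iff, mem_union, mem_inter_iff, mem_compl_iff,
          mem_ofPred_eq]
        constructor
        · intro h
          by_cases hy : y ∈ ⋃ w, J w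
          · exact Or.inl (h ▸ hq y hy)
          · refine Or.inr ⟨hy, ?_⟩
            have h' : ¬ ∃ a, y ∈ J a := fun h => hy (mem_iUnion.2 h)
            rw [← h]
            simp only [q, dif_neg h']
        · rintro (h | ⟨h, rfl⟩)
          · exact hq' y a h
          · have h' : ¬ ∃ a, y ∈ J a := fun h'' => h (mem_iUnion.2 h'')
            simp only [q, dif_neg h']
      rw [this]
      exact (hJc a).measurableSet.union (hKm.compl.inter (MeasurableSet.const _))
    refine ⟨q, hqm, fun n => ?_⟩
    let Aset : ℕ → Finset ℕ := fun j =>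
      (Finset.range (j + (n + 1))).filter fun k => j ≤ k * N ∧ k * N < j + (n + 1)
    have hqq : Measurable (fun x (i : Fin (n + 1)) => q (T^[(i : ℕ)] x)) :=
      measurable_pi_lambda _ fun i => hqm.comp (hTm i)
    have hallK : ∀ᵐ y ∂μ₀, ∀ k : ℕ, (T^[N])^[k] y ∈ ⋃ w, J w := by
      rw [ae_all_iff]
      exact fun k => (hinv.iterate k).quasiMeasurePreserving.ae hK
    have hatom : ∀ j (s : Fin (n + 1) → Fin m),
        (μ₀ (T^[j] ⁻¹' ((fun x (i : Fin (n + 1)) => q (T^[(i : ℕ)] x)) ⁻¹' {s}))).toReal ≤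
        Real.exp (-((Aset j).card * Real.log m)) := by
      intro j s
      have e : Real.exp (-((Aset j).card * Real.log m)) = ((m:ℝ)⁻¹) ^ (Aset j).card := by
        rw [← mul_neg, ← Real.log_inv, Real.exp_nat_mul, Real.exp_log (by positivity)]
      rw [e]
      let s' : ℕ → Fin m := fun k =>
        if h : k * N - j < n + 1 then s ⟨k * N - j, h⟩ else Classical.arbitrary _
      refine le_trans ?_ (hA (Aset j) s')
      refine ENNReal.toReal_mono (measure_ne_top _ _) (measure_mono_ae ?_)
      filter_upwards [hallK] with y hy hys
      refine mem_iInter₂.2 fun k hk => ?_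
      simp only [Aset, Finset.mem_filter] at hk
      have hlt : k * N - j < n + 1 := by omega
      have hys' : (fun i : Fin (n + 1) => q (T^[(i : ℕ)] (T^[j] y))) = s := hys
      have h1 := congrFun hys' ⟨k * N - j, hlt⟩
      simp only at h1
      rw [← Function.iterate_add_apply, Nat.sub_add_cancel hk.2.1] at h1
      have h2 := hq _ (hy k)
      have h3 : (T^[N])^[k] y = T^[k * N] y := by rw [← Function.iterate_mul, mul_comm N k]
      rw [h3, h1] at h2
      simpa only [mem_preimage, s', dif_pos hlt, h3] using h2
    have hent : ∀ j < N, ((Aset j).card : ℝ) * Real.log m ≤ ∑ s, Real.negMulLog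
        ((μ₀ (T^[j] ⁻¹' ((fun x (i : Fin (n + 1)) => q (T^[(i : ℕ)] x)) ⁻¹' {s}))).toReal) := by
      intro j _
      exact le_sum_negMulLog _ _ (fun s => ENNReal.toReal_nonneg)
        (sum_measure_fiber μ₀ (hqq.comp (hTm j))) (hatom j)
    have h := le_sum_negMulLog_average hN _ (fun j s => ENNReal.toReal_nonneg) _ hent
    simp only [partitionEntropy]
    simp only [hmeas _ (hqq (measurableSet_singleton _))]
    refine le_trans ?_ h
    rw [← Finset.sum_mul]
    have hc : ((n + 1 : ℕ) : ℝ) ≤ ∑ j ∈ Finset.range N, ((Aset j).card : ℝ) := by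
      exact_mod_cast le_sum_card_multiples hN (n + 1)
    have hl : 0 ≤ Real.log m := Real.log_natCast_nonneg m
    calc ((n:ℝ) + 1) * (Real.log m / N) = (N:ℝ)⁻¹ * (((n + 1 : ℕ) : ℝ) * Real.log m) := by
          push_cast; field_simp
      _ ≤ _ := by gcongr
  · have h_int : ∀ j, Integrable (fun x => φ (T^[j] x)) μ₀ := fun j =>
      (φ.continuous.comp (hT.iterate j)).integrable_of_hasCompactSupport
        (HasCompactSupport.of_compactSpace _)
    have e : ∫ x, φ x ∂μ = (N:ℝ)⁻¹ * ∫ x, birkhoffSum T φ N x ∂μ₀ := by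
      rw [hμ, integral_smul_measure, integral_finsetSum_measure]
      · simp only [birkhoffSum, ENNReal.toReal_inv, ENNReal.toReal_natCast, smul_eq_mul]
        rw [integral_finsetSum _ fun j _ => h_int j]
        congr 1
        refine Finset.sum_congr rfl fun j _ => ?_
        rw [integral_map (hTm j).aemeasurable φ.continuous.aestronglyMeasurable]
      · intro j _
        have : IsProbabilityMeasure (μ₀.map T^[j]) :=
          Measure.isProbabilityMeasure_map (hTm j).aemeasurable
        exact φ.continuous.integrable_of_hasCompactSupport (HasCompactSupport.of_compactSpace _)
    rw [e, div_eq_inv_mul]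
    refine mul_le_mul_of_nonneg_left ?_ (by positivity)
    have h1 : ∫ _x, β ∂μ₀ = β := by simp
    rw [← h1]
    refine integral_mono_ae (integrable_const _) ?_ ?_
    · exact integrable_finsetSum _ fun j _ => h_int j
    · filter_upwards [hK] with y hy
      obtain ⟨w, hw⟩ := mem_iUnion.1 hy
      exact hβ w y hw

end HorseshoeMeasure

section HyperbolicTimes

/-- Pliss lemma: if `c ≤ A` and the sum of the first `n` terms is at least `2 * lam * n`,
then a fraction at least `lam / A` of the times `t ≤ n` is hyperbolic. -/
theorem pliss {c : ℕ → ℝ} {A lam : ℝ} (hlam : 0 ≤ lam) (hA : 0 ≤ A) (hc : ∀ i, c i ≤ A) {n : ℕ}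
    (hn : 2 * lam * n ≤ ∑ i ∈ Finset.range n, c i) :
    ∃ H : Finset ℕ, lam * n ≤ A * H.card ∧ ∀ t ∈ H, 1 ≤ t ∧ t ≤ n ∧
      ∀ k < t, lam * ((t - k : ℕ) : ℝ) ≤ ∑ i ∈ Finset.Ico k t, c i := by
  classical
  let S : ℕ → ℝ := fun t => ∑ i ∈ Finset.range t, (c i - lam)
  let H : ℕ → Finset ℕ := fun m => (Finset.Icc 1 m).filter fun t => ∀ k < t, S k ≤ S t
  have key : ∀ m, ∀ k ≤ m, S k ≤ A * (H m).card := by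
    intro m
    induction m with
    | zero =>
      intro k hk
      obtain rfl : k = 0 := by omega
      simp only [S, Finset.range_zero, Finset.sum_empty]
      positivity
    | succ m ih =>
      have hsub : H m ⊆ H (m + 1) := by
        intro t ht
        simp only [H, Finset.mem_filter, Finset.mem_Icc] at ht ⊢
        exact ⟨⟨ht.1.1, by omega⟩, ht.2⟩
      have hmono : A * (H m).card ≤ A * (H (m + 1)).card :=
        mul_le_mul_of_nonneg_left (by exact_mod_cast Finset.card_le_card hsub) hA
      intro k hk
      rcases Nat.lt_or_ge k (m + 1) with h | h
      · exact (ih k (by omega)).trans hmono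
      · obtain rfl : k = m + 1 := by omega
        by_cases hrec : ∀ k < m + 1, S k ≤ S (m + 1)
        · have hins : insert (m + 1) (H m) ⊆ H (m + 1) := by
            intro t ht
            rcases Finset.mem_insert.1 ht with rfl | ht
            · simp only [H, Finset.mem_filter, Finset.mem_Icc]
              exact ⟨⟨by omega, le_rfl⟩, hrec⟩
            · exact hsub ht
          have hnot : m + 1 ∉ H m := by
            simp only [H, Finset.mem_filter, Finset.mem_Icc]
            omega
          have hcard := Finset.card_le_card hins
          rw [Finset.card_insert_of_notMem hnot] at hcard
          have hcard' : ((H m).card : ℝ) + 1 ≤ (H (m + 1)).card := by exact_mod_cast hcard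
          have hS : S (m + 1) = S m + (c m - lam) := Finset.sum_range_succ _ _
          have := mul_le_mul_of_nonneg_left hcard' hA
          have h1 := ih m le_rfl
          have h2 := hc m
          rw [hS]; linarith
        · push Not at hrec
          obtain ⟨k, hk, hlt⟩ := hrec
          exact hlt.le.trans ((ih k (by omega)).trans hmono)
  refine ⟨H n, ?_, ?_⟩
  · have h1 := key n n le_rfl
    have h2 : S n = ∑ i ∈ Finset.range n, c i - n * lam := by
      simp only [S, Finset.sum_sub_distrib, Finset.sum_const, Finset.card_range, nsmul_eq_mul]
    rw [h2] at h1
    linarith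
  · intro t ht
    simp only [H, Finset.mem_filter, Finset.mem_Icc] at ht
    refine ⟨ht.1.1, ht.1.2, fun k hk => ?_⟩
    have h1 := ht.2 k hk
    have h2 : S t - S k = ∑ i ∈ Finset.Ico k t, (c i - lam) := by
      rw [Finset.sum_Ico_eq_sub _ hk.le]
    rw [Finset.sum_sub_distrib, Finset.sum_const, Nat.card_Ico, nsmul_eq_mul] at h2
    linarith

theorem exists_spaced_sequence {H : Finset ℕ} {g q : ℕ} (h : g * q < H.card) :
    ∃ t : ℕ → ℕ, (∀ i ≤ q, t i ∈ H) ∧ ∀ i < q, t i + g ≤ t (i + 1) := by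
  let e := H.orderEmbOfFin rfl
  have he : ∀ i j : Fin H.card, i ≤ j → e i + ((j : ℕ) - i) ≤ e j := by
    intro i j hij
    obtain ⟨j, hj⟩ := j
    induction j with
    | zero =>
      have : i = ⟨0, hj⟩ := le_antisymm hij (Fin.mk_le_of_le_val (Nat.zero_le _))
      subst this; simp
    | succ j ih =>
      rcases eq_or_lt_of_le hij with rfl | hlt
      · simp
      · have hlt' : (i : ℕ) < j + 1 := hlt
        have h1 := ih (by omega) (Fin.le_def.2 (by simp; omega))
        have h2 : e ⟨j, by omega⟩ < e ⟨j + 1, hj⟩ := e.strictMono (Fin.lt_def.2 (by simp))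
        simp only at h1 ⊢
        omega
  refine ⟨fun i => if hi : g * i < H.card then e ⟨g * i, hi⟩ else 0, fun i hi => ?_, fun i hi => ?_⟩
  · have : g * i < H.card := lt_of_le_of_lt (Nat.mul_le_mul_left g hi) h
    simp only [dif_pos this]
    exact H.orderEmbOfFin_mem rfl _
  · have h1 : g * i < H.card := lt_of_le_of_lt (Nat.mul_le_mul_left g hi.le) h
    have h2 : g * (i + 1) < H.card := lt_of_le_of_lt (Nat.mul_le_mul_left g hi) h
    simp only [dif_pos h1, dif_pos h2]
    have := he ⟨g * i, h1⟩ ⟨g * (i + 1), h2⟩ (Fin.le_def.2 (by simp; nlinarith))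
    simp only [Nat.mul_succ] at this ⊢
    omega

variable {X : Type*}

theorem exists_itinerary {T : X → X} {ψ : X → ℝ} {B : ℕ} {G : ℕ → Set X}
    {A : ℕ → Fin B → Set X} {len : ℕ → ℕ} {β : ℕ → ℝ} (s : ℕ)
    (h : ∀ i < s, ∀ j, ∀ u ∈ G (i + 1), ∃ v ∈ G i, T^[len i] v = u ∧ v ∈ A i j ∧
      β i ≤ birkhoffSum T ψ (len i) v) (w : ℕ → Fin B) :
    ∀ u ∈ G s, ∃ v ∈ G 0, T^[∑ k ∈ Finset.range s, len k] v = u ∧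
      ∑ k ∈ Finset.range s, β k ≤ birkhoffSum T ψ (∑ k ∈ Finset.range s, len k) v ∧
      ∀ i < s, T^[∑ k ∈ Finset.range i, len k] v ∈ A i (w i) := by
  induction s with
  | zero => intro u hu; exact ⟨u, hu, by simp⟩
  | succ s ih =>
    intro u hu
    obtain ⟨v', hv', hT, hA, hβ⟩ := h s (Nat.lt_succ_self s) (w s) u hu
    obtain ⟨v, hv, hT', hβ', hA'⟩ := ih (fun i hi => h i (by omega)) v' hv'
    refine ⟨v, hv, ?_, ?_, ?_⟩
    · rw [Finset.sum_range_succ, add_comm, Function.iterate_add_apply, hT', hT]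
    · rw [Finset.sum_range_succ, Finset.sum_range_succ, birkhoffSum_add, hT']
      exact add_le_add hβ' hβ
    · intro i hi
      rcases Nat.lt_or_ge i s with h1 | h1
      · exact hA' i h1
      · obtain rfl : i = s := by omega
        rw [hT']; exact hA

/-- `n` is a hyperbolic time for `x`, with rate `lam`, for the cocycle generated by `Ψ`. -/
def IsHyperbolicTime (T : X → X) (Ψ : X → ℝ) (lam : ℝ) (x : X) (n : ℕ) : Prop :=
  ∀ j < n, lam * ((n - j : ℕ) : ℝ) ≤ birkhoffSum T Ψ (n - j) (T^[j] x)

theorem IsHyperbolicTime.shift {T : X → X} {Ψ : X → ℝ} {lam : ℝ} {x : X} {k n : ℕ}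
    (h : IsHyperbolicTime T Ψ lam x n) (_hk : k ≤ n) :
    IsHyperbolicTime T Ψ lam (T^[k] x) (n - k) := by
  intro j hj
  have h1 := h (k + j) (by omega)
  rw [show n - (k + j) = n - k - j by omega] at h1
  rwa [← Function.iterate_add_apply, add_comm j k]

variable [MetricSpace X]

theorem birkhoffSum_sub_le_of_shadow {T : X → X} {ψ : X → ℝ} {Ch α : ℝ} (hα : 0 < α) (hC : 0 ≤ Ch)
    (hψ : ∀ x y, |ψ x - ψ y| ≤ Ch * dist x y ^ α) {r lam : ℝ} (hr : 0 ≤ r) (hlam : 0 < lam)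
    {n : ℕ} {x v : X}
    (h : ∀ j ≤ n, dist (T^[j] v) (T^[j] x) ≤ r * Real.exp (-(lam * ((n - j : ℕ) : ℝ)))) :
    birkhoffSum T ψ n x - birkhoffSum T ψ n v ≤
      Ch * r ^ α * (1 - Real.exp (-(lam * α)))⁻¹ := by
  set ρ := Real.exp (-(lam * α)) with hρ
  have hρ0 : 0 ≤ ρ := (Real.exp_pos _).le
  have hρ1 : ρ < 1 := Real.exp_lt_one_iff.2 (by have := mul_pos hlam hα; linarith)
  have hterm : ∀ j ∈ Finset.range n, ψ (T^[j] x) - ψ (T^[j] v) ≤ Ch * r ^ α * ρ ^ (n - j) := by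
    intro j hj
    have hj' := Finset.mem_range.1 hj
    have h1 := hψ (T^[j] x) (T^[j] v)
    have h2 := h j hj'.le
    rw [dist_comm] at h2
    have h3 : dist (T^[j] x) (T^[j] v) ^ α ≤ r ^ α * ρ ^ (n - j) := by
      refine (Real.rpow_le_rpow dist_nonneg h2 hα.le).trans_eq ?_
      rw [Real.mul_rpow hr (Real.exp_pos _).le, hρ, ← Real.exp_mul, ← Real.exp_nat_mul]
      congr 2; ring
    calc _ ≤ |ψ (T^[j] x) - ψ (T^[j] v)| := le_abs_self _
      _ ≤ _ := h1
      _ ≤ Ch * (r ^ α * ρ ^ (n - j)) := mul_le_mul_of_nonneg_left h3 hC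
      _ = _ := by ring
  simp only [birkhoffSum, ← Finset.sum_sub_distrib]
  refine (Finset.sum_le_sum hterm).trans ?_
  rw [← Finset.mul_sum]
  refine mul_le_mul_of_nonneg_left ?_ (by positivity)
  have e : ∑ j ∈ Finset.range n, ρ ^ (n - j) = ∑ j ∈ Finset.range n, ρ ^ (j + 1) := by
    rw [← Finset.sum_range_reflect]
    refine Finset.sum_congr rfl fun j hj => ?_
    have := Finset.mem_range.1 hj
    congr 1; omega
  rw [e, ← tsum_geometric_of_lt_one hρ0 hρ1]
  refine (Finset.sum_le_sum fun j _ => pow_le_pow_of_le_one hρ0 hρ1.le (Nat.le_succ j)).trans ?_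
  exact (summable_geometric_of_lt_one hρ0 hρ1).sum_le_tsum _ (fun i _ => by positivity)

end HyperbolicTimes

section KatokHorseshoe

variable {X : Type*}

theorem neg_mul_le_birkhoffSum {T : X → X} {ψ : X → ℝ} {S : ℝ} (hS : ∀ x, |ψ x| ≤ S)
    (n : ℕ) (x : X) : -(n * S) ≤ birkhoffSum T ψ n x := by
  have h : ∑ j ∈ Finset.range n, (-S) ≤ birkhoffSum T ψ n x :=
    Finset.sum_le_sum fun j _ => (abs_le.1 (hS _)).1
  simpa using h

variable [MetricSpace X]

/-- Backward contraction of size `r` at rate `lam` along the hyperbolic times of `x`. -/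
def ShadowsAtHyperbolicTimes (T : X → X) (Ψ : X → ℝ) (lam r : ℝ) (x : X) : Prop :=
  ∀ n, IsHyperbolicTime T Ψ lam x n → ∀ u, dist u (T^[n] x) ≤ r →
    ∃ v, T^[n] v = u ∧ ∀ j ≤ n, dist (T^[j] v) (T^[j] x) ≤
      r * Real.exp (-(lam * ((n - j : ℕ) : ℝ)))

theorem mul_exp_neg_le {r lam : ℝ} (hr : 0 ≤ r) (hlam : 0 ≤ lam) (k : ℕ) :
    r * Real.exp (-(lam * (k : ℝ))) ≤ r := by
  refine mul_le_of_le_one_right hr (Real.exp_le_one_iff.2 ?_)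
  have : 0 ≤ lam * (k : ℝ) := by positivity
  linarith

theorem exists_detour {T : X → X} {ψ Ψ : X → ℝ} {Ch α : ℝ} (hα : 0 < α) (hC : 0 ≤ Ch)
    (hψ : ∀ x y, |ψ x - ψ y| ≤ Ch * dist x y ^ α) {S : ℝ} (hS : ∀ x, |ψ x| ≤ S)
    {r lam : ℝ} (hr : 0 ≤ r) (hlam : 0 < lam)
    {x : X} (hx : ∀ k, ShadowsAtHyperbolicTimes T Ψ lam r (T^[k] x))
    {M : ℕ} (hM : ∀ y z, ∃ v, dist v y ≤ r ∧ T^[M] v = z) (z : X)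
    {p q e : ℕ} (hpq : p ≤ q) (hqe : q ≤ e)
    (hq : IsHyperbolicTime T Ψ lam x q) (he : IsHyperbolicTime T Ψ lam x e)
    {u : X} (hu : dist u (T^[e] x) ≤ r) :
    ∃ v, dist v (T^[p] x) ≤ r ∧ T^[e - p + 2 * M] v = u ∧
      (∀ k ≤ q - p, dist (T^[k] v) (T^[p + k] x) ≤ r) ∧
      (∃ y, dist y (T^[q] x) ≤ r ∧ T^[q - p] v = y ∧ dist (T^[M] y) z ≤ r) ∧
      birkhoffSum T ψ (e - p) (T^[p] x) -
          (2 * (Ch * r ^ α * (1 - Real.exp (-(lam * α)))⁻¹) + 2 * M * S) ≤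
        birkhoffSum T ψ (e - p + 2 * M) v := by
  have hqe' : T^[e - q] (T^[q] x) = T^[e] x := by
    rw [← Function.iterate_add_apply]; congr 1; omega
  have hpq' : T^[q - p] (T^[p] x) = T^[q] x := by
    rw [← Function.iterate_add_apply]; congr 1; omega
  obtain ⟨v₁, hv₁, hs₁⟩ := hx q (e - q) (he.shift hqe) u (by rwa [hqe'])
  have hv₁q : dist v₁ (T^[q] x) ≤ r := by
    have := hs₁ 0 (Nat.zero_le _)
    exact this.trans (mul_exp_neg_le hr hlam.le _)
  obtain ⟨v₂, hv₂, hT₂⟩ := hM z v₁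
  obtain ⟨v₃, hv₃, hT₃⟩ := hM (T^[q] x) v₂
  obtain ⟨v, hv, hs⟩ := hx p (q - p) (hq.shift hpq) v₃ (by rwa [hpq'])
  have hs' : ∀ k ≤ q - p, dist (T^[k] v) (T^[p + k] x) ≤ r := by
    intro k hk
    have := (hs k hk).trans (mul_exp_neg_le hr hlam.le _)
    rwa [← Function.iterate_add_apply, add_comm k p] at this
  have hlen : e - p + 2 * M = (q - p) + (2 * M + (e - q)) := by omega
  have hTT : T^[2 * M] v₃ = v₁ := by
    rw [two_mul, Function.iterate_add_apply, hT₃, hT₂]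
  refine ⟨v, ?_, ?_, hs', ⟨v₃, hv₃, hv, by rwa [hT₃]⟩, ?_⟩
  · simpa using hs' 0 (Nat.zero_le _)
  · rw [hlen, add_comm, Function.iterate_add_apply, hv, add_comm, Function.iterate_add_apply, hTT,
      hv₁]
  · rw [hlen, birkhoffSum_add, hv, birkhoffSum_add, hTT, show e - p = (q - p) + (e - q) by omega,
      birkhoffSum_add, hpq']
    have h1 := birkhoffSum_sub_le_of_shadow hα hC hψ hr hlam hs
    have h2 := birkhoffSum_sub_le_of_shadow hα hC hψ hr hlam hs₁
    have h3 := neg_mul_le_birkhoffSum (T := T) hS (2 * M) v₃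
    push_cast at h3
    linarith

theorem exists_horseshoe_of_hyperbolicTimes {T : X → X} (hT : Continuous T) {ψ Ψ : X → ℝ}
    (hψc : Continuous ψ) {Ch α : ℝ} (hα : 0 < α) (hC : 0 ≤ Ch)
    (hψ : ∀ x y, |ψ x - ψ y| ≤ Ch * dist x y ^ α) {S : ℝ} (hS : ∀ x, |ψ x| ≤ S)
    {r lam : ℝ} (hr : 0 ≤ r) (hlam : 0 < lam)
    {x : X} (hx : ∀ k, ShadowsAtHyperbolicTimes T Ψ lam r (T^[k] x))
    {M : ℕ} (hM1 : 1 ≤ M) (hM : ∀ y z, ∃ v, dist v y ≤ r ∧ T^[M] v = z)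
    {far : X → X} (hfar : ∀ y, 2 * r < dist y (far y))
    {B s : ℕ} {t : ℕ → ℕ} (ht : ∀ i ≤ s * B, IsHyperbolicTime T Ψ lam x (t i))
    (hgap : ∀ i < s * B, t i + M ≤ t (i + 1)) :
    ∃ N, 1 ≤ N ∧ ∃ J : Fin (B ^ s) → Set X, (∀ w, IsClosed (J w)) ∧
      (Pairwise fun v w => Disjoint (J v) (J w)) ∧ (∀ w z, ∃ y ∈ J w, T^[N] y = z) ∧
      ∀ w, ∀ y ∈ J w, birkhoffSum T ψ (t (s * B) - t 0) (T^[t 0] x) -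
          s * (2 * (Ch * r ^ α * (1 - Real.exp (-(lam * α)))⁻¹) + 2 * M * S) - M * S ≤
        birkhoffSum T ψ N y := by
  set C := 2 * (Ch * r ^ α * (1 - Real.exp (-(lam * α)))⁻¹) + 2 * M * S with hCdef
  have hadd : ∀ d i, i + d ≤ s * B → t i ≤ t (i + d) ∧ (1 ≤ d → t i + M ≤ t (i + d)) := by
    intro d
    induction d with
    | zero => intro i _; simp
    | succ d ih =>
      intro i hi
      have h1 := (ih i (by omega)).1
      have h2 := hgap (i + d) (by omega)
      rw [← add_assoc]
      omega
  have hmono : ∀ i j, i ≤ j → j ≤ s * B → t i ≤ t j := by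
    intro i j hij hj
    have := (hadd (j - i) i (by omega)).1
    rwa [Nat.add_sub_cancel' hij] at this
  have hmono' : ∀ i j, i < j → j ≤ s * B → t i + M ≤ t j := by
    intro i j hij hj
    have := (hadd (j - i) i (by omega)).2 (by omega)
    rwa [Nat.add_sub_cancel' hij.le] at this
  have hblk : ∀ i < s, ∀ j ≤ B, i * B + j ≤ s * B := by
    intro i hi j hj
    calc i * B + j ≤ i * B + B := by omega
      _ = (i + 1) * B := by ring
      _ ≤ s * B := Nat.mul_le_mul_right B hi
  let G : ℕ → Set X := fun i => closedBall (T^[t (i * B)] x) r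
  let A : ℕ → Fin B → Set X := fun i j =>
    {v | (∀ j' : Fin B, j' < j → dist (T^[t (i * B + j') - t (i * B) + M] v)
        (T^[t (i * B + j') + M] x) ≤ r) ∧
      dist (T^[t (i * B + j) - t (i * B) + M] v) (far (T^[t (i * B + j) + M] x)) ≤ r}
  let len : ℕ → ℕ := fun i => t ((i + 1) * B) - t (i * B) + 2 * M
  let β : ℕ → ℝ := fun i =>
    birkhoffSum T ψ (t ((i + 1) * B) - t (i * B)) (T^[t (i * B)] x) - C
  have hstep : ∀ i < s, ∀ j, ∀ u ∈ G (i + 1), ∃ v ∈ G i, T^[len i] v = u ∧ v ∈ A i j ∧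
      β i ≤ birkhoffSum T ψ (len i) v := by
    intro i hi j u hu
    have hj := hblk i hi j j.2.le
    have hB := hblk i hi B le_rfl
    rw [← Nat.succ_mul] at hB
    have hpq : t (i * B) ≤ t (i * B + j) := hmono _ _ (by omega) hj
    have hqe : t (i * B + j) ≤ t ((i + 1) * B) :=
      hmono _ _ (by rw [Nat.succ_mul]; have := j.2; omega) hB
    obtain ⟨v, hv, hTv, hsh, ⟨y, _, hy, hfy⟩, hbs⟩ := exists_detour hα hC hψ hS hr hlam hx hM
      (far (T^[t (i * B + j) + M] x)) hpq hqe (ht _ hj) (ht _ hB) hu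
    refine ⟨v, hv, hTv, ⟨fun j' hj' => ?_, ?_⟩, hbs⟩
    · have hlt : i * B + (j' : ℕ) < i * B + j := by have := Fin.lt_def.1 hj'; omega
      have h1 := hmono' _ _ hlt hj
      have h2 : t (i * B) ≤ t (i * B + j') := hmono _ _ (by omega) (by omega)
      have := hsh (t (i * B + j') - t (i * B) + M) (by omega)
      rwa [show t (i * B) + (t (i * B + j') - t (i * B) + M) = t (i * B + j') + M by omega] at this
    · rw [add_comm _ M, Function.iterate_add_apply, hy]
      exact hfy
  have hAc : ∀ i j, IsClosed (A i j) := by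
    intro i j
    have h1 : A i j = (⋂ j' : Fin B, ⋂ _ : j' < j, {v | dist (T^[t (i * B + j') - t (i * B) + M] v)
        (T^[t (i * B + j') + M] x) ≤ r}) ∩
      {v | dist (T^[t (i * B + j) - t (i * B) + M] v) (far (T^[t (i * B + j) + M] x)) ≤ r} := by
      ext v
      simp only [A, mem_inter_iff, mem_iInter, mem_ofPred_eq]
    rw [h1]
    refine IsClosed.inter (isClosed_iInter fun j' => isClosed_iInter fun _ => ?_) ?_ <;>
    exact isClosed_le ((hT.iterate _).dist continuous_const) continuous_const
  have hAd : ∀ i, ∀ j j' : Fin B, j' < j → Disjoint (A i j') (A i j) := by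
    intro i j j' hlt
    refine disjoint_left.2 fun v hv' hv => ?_
    have h1 := hv.1 j' hlt
    have h2 := hv'.2
    have h3 := hfar (T^[t (i * B + j') + M] x)
    have h4 := dist_triangle_left (T^[t (i * B + j') + M] x) (far (T^[t (i * B + j') + M] x))
      (T^[t (i * B + j') - t (i * B) + M] v)
    linarith
  let Λ : ℕ → ℕ := fun i => ∑ k ∈ Finset.range i, len k
  let J' : (Fin s → Fin B) → Set X := fun w =>
    (⋂ i : Fin s, T^[Λ i] ⁻¹' A i (w i)) ∩
      {v | ∑ k ∈ Finset.range s, β k - M * S ≤ birkhoffSum T ψ (Λ s + M) v}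
  have hbc : Continuous (birkhoffSum T ψ (Λ s + M)) :=
    continuous_finsetSum _ fun k _ => hψc.comp (hT.iterate k)
  have htel : ∀ k ≤ s, ∑ i ∈ Finset.range k, β i =
      birkhoffSum T ψ (t (k * B) - t 0) (T^[t 0] x) - k * C := by
    intro k
    induction k with
    | zero => intro _; simp
    | succ k ih =>
      intro hk
      have h1 : t 0 ≤ t (k * B) := hmono _ _ (Nat.zero_le _) (Nat.mul_le_mul_right B (by omega))
      have h2 : t (k * B) ≤ t ((k + 1) * B) :=
        hmono _ _ (Nat.mul_le_mul_right B (by omega)) (Nat.mul_le_mul_right B hk)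
      rw [Finset.sum_range_succ, ih (by omega),
        show t ((k + 1) * B) - t 0 = (t (k * B) - t 0) + (t ((k + 1) * B) - t (k * B)) by omega,
        birkhoffSum_add, ← Function.iterate_add_apply,
        show t (k * B) - t 0 + t 0 = t (k * B) by omega]
      simp only [β]
      push_cast
      ring
  refine ⟨Λ s + M, by omega, fun w => J' (finFunctionFinEquiv.symm w), fun w => ?_, ?_, ?_, ?_⟩
  · exact (isClosed_iInter fun i => (hAc _ _).preimage (hT.iterate _)).inter
      (isClosed_le continuous_const hbc)
  · intro w w' hne
    have hne' : finFunctionFinEquiv.symm w ≠ finFunctionFinEquiv.symm w' :=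
      fun h => hne (finFunctionFinEquiv.symm.injective h)
    obtain ⟨i, hi⟩ := Function.ne_iff.1 hne'
    refine disjoint_left.2 fun v hv hv' => ?_
    have h1 := mem_iInter.1 hv.1 i
    have h2 := mem_iInter.1 hv'.1 i
    rcases lt_or_gt_of_ne hi with h | h
    · exact disjoint_left.1 (hAd _ _ _ h) h1 h2
    · exact disjoint_left.1 (hAd _ _ _ h) h2 h1
  · intro w z
    rcases Nat.eq_zero_or_pos s with rfl | hs
    · obtain ⟨u, hu, hTu⟩ := hM x z
      refine ⟨u, ⟨by simp, ?_⟩, by simpa [Λ] using hTu⟩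
      have := neg_mul_le_birkhoffSum (T := T) hS M u
      simp only [Finset.range_zero, Finset.sum_empty, Λ, mem_ofPred_eq, zero_add]
      linarith
    · have hBpos : 0 < B := by
        have := (finFunctionFinEquiv.symm w ⟨0, hs⟩).2
        omega
      let w' : ℕ → Fin B := fun i =>
        if h : i < s then finFunctionFinEquiv.symm w ⟨i, h⟩ else ⟨0, hBpos⟩
      obtain ⟨u, hu, hTu⟩ := hM (T^[t (s * B)] x) z
      obtain ⟨v, hv, hTv, hβ, hA⟩ := exists_itinerary s hstep w' u hu
      refine ⟨v, ⟨mem_iInter.2 fun i => ?_, ?_⟩, ?_⟩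
      · have := hA i i.2
        simp only [w', dif_pos i.2] at this
        exact this
      · have := neg_mul_le_birkhoffSum (T := T) hS M u
        simp only [mem_ofPred_eq]
        rw [birkhoffSum_add]
        simp only [Λ]
        rw [hTv]
        linarith
      · rw [add_comm, Function.iterate_add_apply]
        simp only [Λ]
        rw [hTv, hTu]
  · intro w y hy
    have h1 := hy.2
    rw [mem_ofPred_eq, htel s le_rfl] at h1
    exact h1

end KatokHorseshoe

section PositivePressure

variable {X : Type*} [MeasurableSpace X]

theorem integrable_birkhoffSum {T : X → X} {μ : Measure X} (hT : MeasurePreserving T μ μ)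
    {g : X → ℝ} (hg : Integrable g μ) (n : ℕ) :
    Integrable (birkhoffSum T g n) μ ∧ ∫ x, birkhoffSum T g n x ∂μ = n * ∫ x, g x ∂μ := by
  have h1 : ∀ k, Integrable (fun x => g (T^[k] x)) μ := fun k =>
    (hT.iterate k).integrable_comp_of_integrable hg
  have h2 : ∀ k, ∫ x, g (T^[k] x) ∂μ = ∫ x, g x ∂μ := fun k => by
    have hk := hT.iterate k
    rw [← integral_map (φ := T^[k]) hk.measurable.aemeasurable
      (by rw [hk.map_eq]; exact hg.aestronglyMeasurable), hk.map_eq]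
  refine ⟨integrable_finsetSum _ fun k _ => h1 k, ?_⟩
  simp only [birkhoffSum]
  rw [integral_finsetSum _ fun k _ => h1 k]
  simp [h2]

variable [MetricSpace X] [CompactSpace X] [BorelSpace X]

/-- If orbits can be shadowed at hyperbolic times of a cocycle `Ψ` with positive integral, the
orbit sums of `ψ` grow at most subexponentially and `∫ ψ = 0`, then some horseshoe has positive
pressure. -/
theorem exists_horseshoe_of_integral_pos {T : X → X} (hT : Continuous T) {ψ Ψ : X → ℝ}
    (hψc : Continuous ψ) {Ch α : ℝ} (hα : 0 < α) (hC : 0 ≤ Ch)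
    (hψ : ∀ x y, |ψ x - ψ y| ≤ Ch * dist x y ^ α)
    (hψup : ∀ ε > 0, ∃ C, ∀ n x, birkhoffSum T ψ n x ≤ ε * n + C)
    {μ : Measure X} [IsProbabilityMeasure μ] (hμ : MeasurePreserving T μ μ)
    (hψμ : ∫ x, ψ x ∂μ = 0)
    {A : ℝ} (hA : ∀ x, Ψ x ≤ A) (hΨ : Integrable Ψ μ) {r lam : ℝ} (hr : 0 ≤ r) (hlam : 0 < lam)
    (hΨμ : 4 * lam ≤ ∫ x, Ψ x ∂μ)
    (hx : ∀ᵐ x ∂μ, ∀ k, ShadowsAtHyperbolicTimes T Ψ lam r (T^[k] x))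
    {M : ℕ} (hM1 : 1 ≤ M) (hM : ∀ y z, ∃ v, dist v y ≤ r ∧ T^[M] v = z)
    {far : X → X} (hfar : ∀ y, 2 * r < dist y (far y)) :
    ∃ N m : ℕ, 1 ≤ N ∧ 1 ≤ m ∧ ∃ J : Fin m → Set X, (∀ w, IsClosed (J w)) ∧
      (Pairwise fun v w => Disjoint (J v) (J w)) ∧ (∀ w z, ∃ y ∈ J w, T^[N] y = z) ∧
      ∃ β : ℝ, (∀ w, ∀ y ∈ J w, β ≤ birkhoffSum T ψ N y) ∧ 0 < Real.log m + β := by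
  obtain ⟨S, hS0, hS⟩ : ∃ S, 0 ≤ S ∧ ∀ x, |ψ x| ≤ S := by
    obtain ⟨S, hS⟩ := isCompact_univ.exists_bound_of_continuousOn hψc.continuousOn
    exact ⟨|S|, abs_nonneg S, fun x => (hS x (mem_univ x)).trans (le_abs_self S)⟩
  have hApos : 0 < A := by
    have h1 : ∫ x, Ψ x ∂μ ≤ ∫ _x, A ∂μ := integral_mono hΨ (integrable_const _) hA
    simp at h1
    linarith
  set C := 2 * (Ch * r ^ α * (1 - Real.exp (-(lam * α)))⁻¹) + 2 * M * S with hCdef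
  obtain ⟨B, hBpos, hB⟩ : ∃ B : ℕ, 1 ≤ B ∧ C + 1 ≤ Real.log B := by
    obtain ⟨B, hB⟩ := exists_nat_ge (Real.exp (C + 1))
    have hpos := Real.exp_pos (C + 1)
    have hB0 : (0:ℝ) < B := hpos.trans_le hB
    exact ⟨B, by exact_mod_cast hB0, (Real.le_log_iff_exp_le hB0).2 hB⟩
  have hMpos : (0:ℝ) < M := by exact_mod_cast hM1
  have hBpos' : (0:ℝ) < B := by exact_mod_cast hBpos
  set κ := lam / (A * (2 * (M * B))) with hκ
  have hκpos : 0 < κ := by positivity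
  set K := 4 * A / κ with hK
  have hKpos : 0 < K := by positivity
  set ε := min (κ / 8) (lam / K) with hε
  have hεpos : 0 < ε := by positivity
  obtain ⟨D, hD⟩ := hψup ε hεpos
  have hD0 : 0 ≤ D := by
    have hne : Nonempty X := by
      by_contra h
      rw [not_nonempty_iff] at h
      have : μ univ = 0 := by rw [univ_eq_empty_iff.2 h, measure_empty]
      simp at this
    simpa using hD 0 hne.some
  obtain ⟨n, hn⟩ := exists_nat_gt (max (K * D / lam)
    (max (2 / κ) ((1 + 2 * D + M * S) / (κ / 4))))
  obtain ⟨hn1, hn2, hn3⟩ := max_lt_iff.1 hn |>.imp_right max_lt_iff.1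
  have hnpos : (0:ℝ) < n := (by positivity : 0 < 2 / κ).trans hn2
  rw [div_lt_iff₀ hlam] at hn1
  rw [div_lt_iff₀ hκpos] at hn2
  rw [div_lt_iff₀ (by positivity)] at hn3
  have hψint : Integrable ψ μ :=
    hψc.integrable_of_hasCompactSupport (HasCompactSupport.of_compactSpace _)
  obtain ⟨x, hxx, hxn⟩ : ∃ x, (∀ k, ShadowsAtHyperbolicTimes T Ψ lam r (T^[k] x)) ∧
      n * (4 * lam) ≤ birkhoffSum T Ψ n x + K * birkhoffSum T ψ n x := by
    obtain ⟨i1, e1⟩ := integrable_birkhoffSum hμ hΨ n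
    obtain ⟨i2, e2⟩ := integrable_birkhoffSum hμ hψint n
    have hnull : μ {x | ∀ k, ShadowsAtHyperbolicTimes T Ψ lam r (T^[k] x)}ᶜ = 0 := hx
    obtain ⟨x, hx1, hx2⟩ := exists_notMem_null_integral_le
      (i1.add (i2.const_mul K)) hnull
    refine ⟨x, not_not.1 hx1, ?_⟩
    have e3 : ∫ y, (birkhoffSum T Ψ n + fun y => K * birkhoffSum T ψ n y) y ∂μ =
        n * ∫ y, Ψ y ∂μ := by
      rw [integral_add' i1 (i2.const_mul K), integral_const_mul, e1, e2, hψμ]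
      ring
    rw [e3] at hx2
    exact (mul_le_mul_of_nonneg_left hΨμ hnpos.le).trans hx2
  have hΨle : birkhoffSum T Ψ n x ≤ n * A := by
    have h : birkhoffSum T Ψ n x ≤ ∑ j ∈ Finset.range n, A := Finset.sum_le_sum fun j _ => hA _
    simpa using h
  have hψlow : -(κ / 4 * n) ≤ birkhoffSum T ψ n x := by
    have h1 : -(n * A) ≤ K * birkhoffSum T ψ n x := by
      have := mul_pos hnpos hlam
      linarith
    have h2 : K * (κ / 4) = A := by rw [hK]; field_simp
    by_contra hlt
    push Not at hlt
    have := mul_lt_mul_of_pos_left hlt hKpos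
    have e : K * -(κ / 4 * n) = -(n * A) := by rw [← h2]; ring
    linarith
  have hΨlow : 2 * lam * n ≤ ∑ i ∈ Finset.range n, Ψ (T^[i] x) := by
    have h1 := hD n x
    have h2 : K * birkhoffSum T ψ n x ≤ K * (ε * n + D) := mul_le_mul_of_nonneg_left h1 hKpos.le
    have h3 : K * ε ≤ lam := by
      rw [← le_div_iff₀' hKpos]; exact min_le_right _ _
    have h4 := mul_le_mul_of_nonneg_right h3 hnpos.le
    have h5 : birkhoffSum T Ψ n x = ∑ i ∈ Finset.range n, Ψ (T^[i] x) := rfl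
    rw [← h5]
    nlinarith
  obtain ⟨H, hHcard, hH⟩ := pliss hlam.le hApos.le (fun i => hA (T^[i] x)) hΨlow
  have hHcard' : 2 * (M * B) * (κ * n) ≤ H.card := by
    have : lam * n = A * (2 * (M * B) * (κ * n)) := by rw [hκ]; field_simp
    rw [this] at hHcard
    exact le_of_mul_le_mul_left hHcard hApos
  obtain ⟨s, hs1, hs2⟩ : ∃ s : ℕ, κ * n ≤ s ∧ (s:ℝ) < 2 * (κ * n) := by
    refine ⟨⌈κ * n⌉₊, Nat.le_ceil _, ?_⟩
    have := Nat.ceil_lt_add_one (by positivity : 0 ≤ κ * n)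
    linarith
  have hcard : M * (s * B) < H.card := by
    have : ((M * (s * B) : ℕ) : ℝ) < H.card := by
      refine lt_of_lt_of_le ?_ hHcard'
      push_cast
      have := mul_lt_mul_of_pos_left hs2 (mul_pos hMpos hBpos')
      linarith
    exact_mod_cast this
  obtain ⟨t, htH, htgap⟩ := exists_spaced_sequence hcard
  have htyp : ∀ i ≤ s * B, IsHyperbolicTime T Ψ lam x (t i) := by
    intro i hi j hj
    have h1 := (hH _ (htH i hi)).2.2 j hj
    refine h1.trans_eq ?_
    rw [Finset.sum_Ico_eq_sum_range]
    simp only [birkhoffSum]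
    refine Finset.sum_congr rfl fun k _ => ?_
    rw [← Function.iterate_add_apply, add_comm]
  obtain ⟨N, hN, J, hJc, hJd, hJ, hJβ⟩ := exists_horseshoe_of_hyperbolicTimes hT hψc hα hC hψ hS hr
    hlam hxx hM1 hM hfar htyp htgap
  refine ⟨N, B ^ s, hN, Nat.one_le_pow _ _ hBpos, J, hJc, hJd, hJ, _, hJβ, ?_⟩
  rw [← hCdef]
  have hmono : ∀ d ≤ s * B, t 0 ≤ t d := by
    intro d
    induction d with
    | zero => simp
    | succ d ih => intro hd; have := htgap d (by omega); have := ih (by omega); omega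
  have h0 := hmono _ le_rfl
  have hT1 : t (s * B) ≤ n := (hH _ (htH _ le_rfl)).2.1
  have hsplit : birkhoffSum T ψ n x = birkhoffSum T ψ (t 0) x +
      (birkhoffSum T ψ (t (s * B) - t 0) (T^[t 0] x) +
        birkhoffSum T ψ (n - t (s * B)) (T^[t (s * B)] x)) := by
    have e1 : birkhoffSum T ψ (n - t (s * B)) (T^[t (s * B)] x) =
        birkhoffSum T ψ (n - t (s * B)) (T^[t (s * B) - t 0] (T^[t 0] x)) := by
      rw [← Function.iterate_add_apply, Nat.sub_add_cancel h0]
    rw [e1, ← birkhoffSum_add, ← birkhoffSum_add]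
    congr 1; omega
  have b1 := hD (t 0) x
  have b2 := hD (n - t (s * B)) (T^[t (s * B)] x)
  have b3 : ((n - t (s * B) : ℕ) : ℝ) + t 0 ≤ n := by
    exact_mod_cast (by omega : n - t (s * B) + t 0 ≤ n)
  have b4 := mul_le_mul_of_nonneg_left b3 hεpos.le
  have b5 : ε * n ≤ κ / 8 * n := mul_le_mul_of_nonneg_right (min_le_left _ _) hnpos.le
  rw [Nat.cast_pow, Real.log_pow]
  have b6 : (s:ℝ) * (C + 1) ≤ s * Real.log B := mul_le_mul_of_nonneg_left hB (Nat.cast_nonneg _)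
  nlinarith

end PositivePressure

section Transfer

theorem partitionEntropy_nonneg {X ι : Type*} [MeasurableSpace X] [Fintype ι]
    (μ : Measure X) [IsProbabilityMeasure μ] (p : X → ι) : 0 ≤ partitionEntropy μ p :=
  Finset.sum_nonneg fun i _ => Real.negMulLog_nonneg ENNReal.toReal_nonneg
    (ENNReal.toReal_le_of_le_ofReal zero_le_one (by simpa using prob_le_one))

theorem exists_covering_of_lipschitz {a b : ℝ} (hab : a ≤ b) {T : Icc a b → Icc a b} {L : ℝ}
    (hL : 1 ≤ L) (hT : ∀ x y, dist (T x) (T y) ≤ L * dist x y) {η : ℝ} (hη : 0 < η) :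
    ∃ C : ℝ, 1 ≤ C ∧ ∀ n : ℕ, ∃ R : Finset (Icc a b), (R.card : ℝ) ≤ C * L ^ n ∧
      ∀ x, ∃ r ∈ R, ∀ i < n, dist (T^[i] x) (T^[i] r) ≤ η := by
  classical
  have hLpos : 0 < L := by linarith
  have hiter : ∀ i x y, dist (T^[i] x) (T^[i] y) ≤ L ^ i * dist x y := by
    intro i
    induction i with
    | zero => intro x y; simp
    | succ i ih =>
      intro x y
      rw [Function.iterate_succ_apply', Function.iterate_succ_apply', pow_succ']
      refine (hT _ _).trans ?_
      rw [mul_assoc]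
      exact mul_le_mul_of_nonneg_left (ih x y) hLpos.le
  refine ⟨(b - a) / η + 1, ?_, fun n => ?_⟩
  · have : 0 ≤ (b - a) / η := div_nonneg (by linarith) hη.le
    linarith
  · set δ := η / L ^ n with hδ
    have hδpos : 0 < δ := by positivity
    let pt : ℕ → Icc a b := fun k => projIcc a b hab (a + k * δ)
    refine ⟨(Finset.range (⌊(b - a) / δ⌋₊ + 1)).image pt, ?_, fun x => ?_⟩
    · have h1 : (((Finset.range (⌊(b - a) / δ⌋₊ + 1)).image pt).card : ℝ) ≤ ⌊(b - a) / δ⌋₊ + 1 := by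
        exact_mod_cast Finset.card_image_le.trans_eq (Finset.card_range _)
      have h2 : (⌊(b - a) / δ⌋₊ : ℝ) ≤ (b - a) / δ :=
        Nat.floor_le (div_nonneg (by linarith) hδpos.le)
      have h3 : (b - a) / δ = (b - a) / η * L ^ n := by rw [hδ]; field_simp
      have h4 : 1 ≤ L ^ n := one_le_pow₀ hL
      replace h2 := h2.trans_eq h3
      linarith
    · have hx := x.2
      set k := ⌊((x : ℝ) - a) / δ⌋₊ with hk
      have hxa : 0 ≤ ((x : ℝ) - a) / δ := div_nonneg (by linarith [hx.1]) hδpos.le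
      have h1 : (k : ℝ) * δ ≤ x - a := (le_div_iff₀ hδpos).1 (Nat.floor_le hxa)
      have h2 : (x : ℝ) - a < (k + 1) * δ := (div_lt_iff₀ hδpos).1 (Nat.lt_floor_add_one _)
      refine ⟨pt k, Finset.mem_image_of_mem _ (Finset.mem_range.2 (Nat.lt_succ_of_le
        (Nat.floor_mono (by gcongr; exact hx.2)))), fun i hi => (hiter i _ _).trans ?_⟩
      have hmem : a + k * δ ∈ Icc a b := ⟨by nlinarith, by linarith [hx.2]⟩
      have h3 : dist x (pt k) ≤ δ := by
        rw [Subtype.dist_eq]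
        simp only [pt, projIcc_of_mem hab hmem]
        rw [Real.dist_eq, abs_le]
        constructor <;> linarith
      have h4 : L ^ i ≤ L ^ n := pow_le_pow_right₀ hL hi.le
      calc L ^ i * dist x (pt k) ≤ L ^ n * δ := by gcongr
        _ = η := by rw [hδ]; field_simp

variable {a b : ℝ} {f : ℝ → ℝ} (hf : MapsTo f (Icc a b) (Icc a b))

theorem coe_iterate_restrict (n : ℕ) (x : Icc a b) :
    (((hf.restrict f _ _)^[n] x : Icc a b) : ℝ) = f^[n] x := by
  induction n with
  | zero => rfl
  | succ n ih => rw [Function.iterate_succ_apply', Function.iterate_succ_apply', ← ih]; rfl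

theorem map_val_apply (ν : Measure (Icc a b)) (A : Set ℝ) :
    ν.map Subtype.val A = ν (Subtype.val ⁻¹' A) :=
  (MeasurableEmbedding.subtype_coe measurableSet_Icc).map_apply ν A

theorem invariantProb_map_val {ν : Measure (Icc a b)} [IsProbabilityMeasure ν]
    (hν : MeasurePreserving (hf.restrict f _ _) ν ν) :
    InvariantProb f (Icc a b) (ν.map Subtype.val) := by
  refine ⟨Measure.isProbabilityMeasure_map measurable_subtype_coe.aemeasurable, ?_, fun A hA => ?_⟩
  · rw [map_val_apply]; simp
  · rw [map_val_apply, map_val_apply,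
      ← hν.measure_preimage (measurable_subtype_coe hA).nullMeasurableSet]
    rfl

theorem InvariantProb.exists_eq_map_val (hfm : Measurable (hf.restrict f _ _)) {μ : Measure ℝ}
    (hμ : InvariantProb f (Icc a b) μ) :
    ∃ ν : Measure (Icc a b), IsProbabilityMeasure ν ∧
      MeasurePreserving (hf.restrict f _ _) ν ν ∧ μ = ν.map Subtype.val := by
  obtain ⟨hp, h1, hinv⟩ := hμ
  have he := MeasurableEmbedding.subtype_coe (measurableSet_Icc (a := a) (b := b))
  have hc : μ (Icc a b)ᶜ = 0 := (prob_compl_eq_zero_iff measurableSet_Icc).2 h1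
  have hnull : ∀ A B : Set ℝ, A ∩ Icc a b = B ∩ Icc a b → μ A = μ B := by
    intro A B h
    have key : ∀ A : Set ℝ, μ A = μ (A ∩ Icc a b) := fun A => by
      refine le_antisymm ?_ (measure_mono inter_subset_left)
      calc μ A ≤ μ (A ∩ Icc a b ∪ (Icc a b)ᶜ) := measure_mono fun x hx => by
            by_cases h : x ∈ Icc a b
            · exact Or.inl ⟨hx, h⟩
            · exact Or.inr h
        _ ≤ _ := (measure_union_le _ _).trans (by rw [hc, add_zero])
    rw [key A, key B, h]
  have hmap : μ = (μ.comap Subtype.val).map (Subtype.val : Icc a b → ℝ) := by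
    ext A _
    rw [map_val_apply, he.comap_apply, Subtype.image_preimage_coe]
    exact hnull _ _ (by ext; simp; tauto)
  refine ⟨μ.comap Subtype.val, ⟨?_⟩, ⟨hfm, ?_⟩, hmap⟩
  · rw [he.comap_apply, image_univ, Subtype.range_coe]; exact h1
  · ext B hB
    rw [Measure.map_apply hfm hB, he.comap_apply, he.comap_apply, ← hinv _ (he.measurableSet_image.2 hB)]
    refine hnull _ _ ?_
    ext x
    simp only [mem_inter_iff, mem_image, mem_preimage]
    constructor
    · rintro ⟨⟨y, hy, rfl⟩, hx⟩
      exact ⟨⟨_, hy, rfl⟩, hx⟩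
    · rintro ⟨⟨y, hy, hxy⟩, hx⟩
      refine ⟨⟨⟨x, hx⟩, ?_, rfl⟩, hx⟩
      have : hf.restrict f _ _ ⟨x, hx⟩ = y := Subtype.ext hxy.symm
      rwa [this]

theorem partitionEntropy_map_val (ν : Measure (Icc a b)) {k : ℕ} (p : ℝ → Fin k) (n : ℕ) :
    partitionEntropy (ν.map Subtype.val) (fun x (i : Fin n) => p (f^[(i : ℕ)] x)) =
      partitionEntropy ν (fun x (i : Fin n) => (p ∘ Subtype.val) ((hf.restrict f _ _)^[(i:ℕ)] x)) := by
  unfold partitionEntropy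
  refine Finset.sum_congr rfl fun s _ => ?_
  rw [map_val_apply]
  simp only [Function.comp_apply, coe_iterate_restrict]
  rfl

variable {L : ℝ} {φ : ℝ → ℝ}

theorem iInf_entropy_le (hf : MapsTo f (Icc a b) (Icc a b)) (hL : 1 ≤ L)
    (hfL : ∀ x ∈ Icc a b, ∀ y ∈ Icc a b, |f x - f y| ≤ L * |x - y|)
    {μ : Measure ℝ} (hμ : InvariantProb f (Icc a b) μ) {k : ℕ} {p : ℝ → Fin k} (hp : Measurable p) :
    ⨅ n : ℕ, partitionEntropy μ (fun x (i : Fin (n + 1)) => p (f^[(i : ℕ)] x)) / (n + 1) ≤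
      Real.log L + Real.log 2 + 1 := by
  have hlip : ∀ x y, dist (hf.restrict f _ _ x) (hf.restrict f _ _ y) ≤ L * dist x y :=
    fun x y => hfL x x.2 y y.2
  have hcont : Continuous (hf.restrict f _ _) :=
    (LipschitzWith.of_dist_le_mul (K := ⟨L, by linarith⟩) hlip).continuous
  obtain ⟨ν, hν, hinv, rfl⟩ := hμ.exists_eq_map_val hf hcont.measurable
  have hne : Nonempty (Icc a b) := by
    by_contra h
    rw [not_nonempty_iff] at h
    have : ν univ = 0 := by rw [univ_eq_empty_iff.2 h, measure_empty]
    simp at this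
  obtain ⟨x₀⟩ := hne
  simp only [partitionEntropy_map_val hf]
  exact iInf_partitionEntropy_le ν hinv hL
    (fun η hη => exists_covering_of_lipschitz (x₀.2.1.trans x₀.2.2) hL hlip hη)
    (hp.comp measurable_subtype_coe)

theorem ksEntropy_le (hf : MapsTo f (Icc a b) (Icc a b)) (hL : 1 ≤ L)
    (hfL : ∀ x ∈ Icc a b, ∀ y ∈ Icc a b, |f x - f y| ≤ L * |x - y|)
    {μ : Measure ℝ} (hμ : InvariantProb f (Icc a b) μ) :
    ksEntropy μ f ≤ Real.log L + Real.log 2 + 1 := by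
  have h0 : 0 ≤ Real.log L + Real.log 2 + 1 := by
    have := Real.log_nonneg hL
    have := Real.log_nonneg one_le_two
    linarith
  exact Real.iSup_le (fun k => Real.iSup_le (fun p => iInf_entropy_le hf hL hfL hμ p.2) h0) h0

theorem le_ksEntropy (hL : 1 ≤ L) (hfL : ∀ x ∈ Icc a b, ∀ y ∈ Icc a b, |f x - f y| ≤ L * |x - y|)
    {ν : Measure (Icc a b)} [IsProbabilityMeasure ν]
    (hν : MeasurePreserving (hf.restrict f _ _) ν ν) {m : ℕ} (hm : 1 ≤ m) {q : Icc a b → Fin m}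
    (hq : Measurable q) {h : ℝ}
    (hh : ∀ n : ℕ, (n + 1) * h ≤
      partitionEntropy ν (fun x (i : Fin (n + 1)) => q ((hf.restrict f _ _)^[(i:ℕ)] x))) :
    h ≤ ksEntropy (ν.map Subtype.val) f := by
  have he := MeasurableEmbedding.subtype_coe (measurableSet_Icc (a := a) (b := b))
  have hinv := invariantProb_map_val hf hν
  have h0 : 0 ≤ Real.log L + Real.log 2 + 1 := by
    have := Real.log_nonneg hL
    have := Real.log_nonneg one_le_two
    linarith
  obtain ⟨p, hp, hpq⟩ := he.exists_measurable_extend hq fun _ => ⟨(⟨0, hm⟩ : Fin m)⟩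
  have hb1 : BddAbove (range fun p : {p : ℝ → Fin m // Measurable p} =>
      ⨅ n : ℕ, partitionEntropy (ν.map Subtype.val) (fun x (i : Fin (n + 1)) => p.1 (f^[(i : ℕ)] x)) /
        (n + 1)) := by
    refine ⟨Real.log L + Real.log 2 + 1, ?_⟩
    rintro _ ⟨p, rfl⟩
    exact iInf_entropy_le hf hL hfL hinv p.2
  have hb2 : BddAbove (range fun k : ℕ => ⨆ p : {p : ℝ → Fin k // Measurable p},
      ⨅ n : ℕ, partitionEntropy (ν.map Subtype.val) (fun x (i : Fin (n + 1)) => p.1 (f^[(i : ℕ)] x)) /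
        (n + 1)) := by
    refine ⟨Real.log L + Real.log 2 + 1, ?_⟩
    rintro _ ⟨k, rfl⟩
    exact Real.iSup_le (fun p => iInf_entropy_le hf hL hfL hinv p.2) h0
  refine le_trans ?_ (le_ciSup hb2 m)
  refine le_trans ?_ (le_ciSup hb1 ⟨p, hp⟩)
  refine le_ciInf fun n => ?_
  rw [le_div_iff₀ (by positivity), mul_comm]
  refine (hh n).trans_eq ?_
  rw [partitionEntropy_map_val hf, hpq]

theorem ksEntropy_nonneg (hL : 1 ≤ L)
    (hfL : ∀ x ∈ Icc a b, ∀ y ∈ Icc a b, |f x - f y| ≤ L * |x - y|)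
    {ν : Measure (Icc a b)} [IsProbabilityMeasure ν]
    (hν : MeasurePreserving (hf.restrict f _ _) ν ν) : 0 ≤ ksEntropy (ν.map Subtype.val) f :=
  le_ksEntropy hf hL hfL hν le_rfl (measurable_const (a := (0 : Fin 1))) fun n => by
    rw [mul_zero]; exact partitionEntropy_nonneg _ _

theorem integral_map_val (ν : Measure (Icc a b)) (φ : ℝ → ℝ) :
    ∫ x, φ x ∂(ν.map Subtype.val) = ∫ x : Icc a b, φ x ∂ν :=
  (MeasurableEmbedding.subtype_coe measurableSet_Icc).integral_map φ

theorem ksEntropy_add_integral_le_pressure (hL : 1 ≤ L)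
    (hfL : ∀ x ∈ Icc a b, ∀ y ∈ Icc a b, |f x - f y| ≤ L * |x - y|)
    (hφ : ContinuousOn φ (Icc a b)) {ν : Measure (Icc a b)} [IsProbabilityMeasure ν]
    (hν : MeasurePreserving (hf.restrict f _ _) ν ν) :
    ksEntropy (ν.map Subtype.val) f + ∫ x : Icc a b, φ x ∂ν ≤ pressure f (Icc a b) φ := by
  obtain ⟨S, hS⟩ := isCompact_Icc.exists_bound_of_continuousOn hφ
  refine le_csSup ⟨Real.log L + Real.log 2 + 1 + S, ?_⟩
    ⟨_, invariantProb_map_val hf hν, by rw [integral_map_val]⟩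
  rintro _ ⟨μ, hμ, rfl⟩
  have : IsProbabilityMeasure μ := hμ.1
  refine add_le_add (ksEntropy_le hf hL hfL hμ) ?_
  have hae : ∀ᵐ x ∂μ, ‖φ x‖ ≤ S := by
    have h1 : ∀ᵐ x ∂μ, x ∈ Icc a b := (prob_compl_eq_zero_iff measurableSet_Icc).2 hμ.2.1
    filter_upwards [h1] with x hx using hS x hx
  have := norm_integral_le_of_norm_le_const hae
  simp at this
  exact (le_abs_self _).trans this

end Transfer

section Reduction

theorem exists_invariant_of_birkhoffSum_ge {X : Type*} [MetricSpace X] [CompactSpace X]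
    [MeasurableSpace X] [BorelSpace X] {T : X → X} (hT : Continuous T) {g : X → ℝ}
    (hg : Continuous g) {c : ℝ}
    (h : ∀ j : ℕ, ∃ n, j < n ∧ ∃ x, c * n ≤ birkhoffSum T g n x) :
    ∃ ν : Measure X, IsProbabilityMeasure ν ∧ MeasurePreserving T ν ν ∧ c ≤ ∫ x, g x ∂ν := by
  choose n hn x hx using h
  have hnt : Tendsto n atTop atTop :=
    tendsto_atTop_mono (fun j => (hn j).le) tendsto_id
  have : Nonempty X := ⟨x 0⟩
  obtain ⟨ν, hν, U, hU, hlim⟩ := exists_invariant_limit_of_orbits hT n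
    (fun j => by have := hn j; omega) hnt (fun _ => Unit) (fun j _ => x j)
  refine ⟨ν, inferInstance, hν, ge_of_tendsto (hlim ⟨g, hg⟩) (Eventually.of_forall fun j => ?_)⟩
  have hpos : (0:ℝ) < n j := by exact_mod_cast (Nat.zero_le j).trans_lt (hn j)
  have h1 := hx j
  simp only [birkhoffSum] at h1
  simp only [Fintype.card_unit, Nat.cast_one, mul_one, Finset.univ_unique, Finset.sum_singleton,
    ContinuousMap.coe_mk]
  rw [← div_eq_inv_mul, le_div_iff₀ hpos]
  exact h1

/-- It suffices to find, for every equilibrium state, a cocycle of positive mean along whose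
hyperbolic times orbits are shadowed. -/
theorem hyperbolicPotential_of_shadowing {a b : ℝ} (hab : a < b) {f φ : ℝ → ℝ}
    (hf : MapsTo f (Icc a b) (Icc a b)) {L : ℝ} (hL : 1 ≤ L)
    (hfL : ∀ x ∈ Icc a b, ∀ y ∈ Icc a b, |f x - f y| ≤ L * |x - y|)
    (hφ : HolderOn φ (Icc a b))
    (h : ∀ ν : Measure (Icc a b), IsProbabilityMeasure ν → MeasurePreserving (hf.restrict f _ _) ν ν →
      IsEquilibriumState f (Icc a b) φ (ν.map Subtype.val) →
      ∃ (Ψ : Icc a b → ℝ) (A r lam : ℝ) (M : ℕ) (far : Icc a b → Icc a b),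
        (∀ x, Ψ x ≤ A) ∧ Integrable Ψ ν ∧ 0 ≤ r ∧ 0 < lam ∧ 4 * lam ≤ ∫ x, Ψ x ∂ν ∧
        (∀ᵐ x ∂ν, ∀ k, ShadowsAtHyperbolicTimes (hf.restrict f _ _) Ψ lam r
          ((hf.restrict f _ _)^[k] x)) ∧ 1 ≤ M ∧
        (∀ y z, ∃ v, dist v y ≤ r ∧ (hf.restrict f _ _)^[M] v = z) ∧
        ∀ y, 2 * r < dist y (far y)) :
    HyperbolicPotential f (Icc a b) φ := by
  set T := hf.restrict f _ _ with hTdef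
  have hlip : ∀ x y, dist (T x) (T y) ≤ L * dist x y := fun x y => hfL x x.2 y y.2
  have hT : Continuous T :=
    (LipschitzWith.of_dist_le_mul (K := ⟨L, by linarith⟩) hlip).continuous
  obtain ⟨Ch, α, hα, hα1, hC, hol⟩ := hφ
  set P := pressure f (Icc a b) φ with hP
  let g : Icc a b → ℝ := fun x => φ x
  have hg : ∀ x y, |g x - g y| ≤ Ch * dist x y ^ α := fun x y => hol x x.2 y y.2
  have hgc : Continuous g := by
    refine continuous_iff_continuousAt.2 fun x => tendsto_iff_dist_tendsto_zero.2
      (squeeze_zero (fun _ => dist_nonneg) (fun y => hg y x) ?_)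
    have : Continuous fun y : Icc a b => Ch * dist y x ^ α :=
      continuous_const.mul ((continuous_id.dist continuous_const).rpow_const fun _ => Or.inr hα.le)
    exact this.tendsto' x 0 (by simp [hα.ne'])
  have hφc : ContinuousOn φ (Icc a b) := continuousOn_iff_continuous_domRestrict.2 hgc
  have hne : Nonempty (Icc a b) := ⟨⟨a, left_mem_Icc.2 hab.le⟩⟩
  have hbirk : ∀ n (x : Icc a b), birkhoffSum T g n x = birkhoffSum f φ n x := by
    intro n x
    simp only [birkhoffSum, g]
    refine Finset.sum_congr rfl fun k _ => ?_
    rw [hTdef, coe_iterate_restrict]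
  have hintP : ∀ ν : Measure (Icc a b), IsProbabilityMeasure ν → MeasurePreserving T ν ν →
      ∫ x, g x ∂ν ≤ P := by
    intro ν _ hν
    have h1 := ksEntropy_nonneg hf hL hfL hν
    have h2 := ksEntropy_add_integral_le_pressure hf hL hfL hφc hν
    linarith
  by_contra hhyp
  obtain ⟨ν, hνp, hν, hνP⟩ : ∃ ν : Measure (Icc a b), IsProbabilityMeasure ν ∧
      MeasurePreserving T ν ν ∧ P ≤ ∫ x, g x ∂ν := by
    refine exists_invariant_of_birkhoffSum_ge hT hgc fun j => ⟨j + 1, by omega, ?_⟩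
    have h1 : ¬ sSup ((fun x => birkhoffSum f φ (j + 1) x / ((j + 1 : ℕ) : ℝ)) '' Icc a b) < P :=
      fun h => hhyp ⟨j + 1, by omega, h⟩
    have hbc : Continuous (birkhoffSum T g (j + 1)) :=
      continuous_finsetSum _ fun k _ => hgc.comp (hT.iterate k)
    obtain ⟨x, -, hx⟩ := isCompact_univ.exists_isMaxOn univ_nonempty hbc.continuousOn
    refine ⟨x, ?_⟩
    by_contra hlt
    push Not at hlt
    have hpos : (0:ℝ) < (j + 1 : ℕ) := by positivity
    refine h1 (lt_of_le_of_lt (csSup_le ((nonempty_Icc.2 hab.le).image _) ?_)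
      ((div_lt_iff₀ hpos).2 hlt))
    rintro _ ⟨y, hy, rfl⟩
    have := hx (mem_univ (⟨y, hy⟩ : Icc a b))
    simp only [mem_ofPred_eq] at this
    simp only
    gcongr
    exact (hbirk (j + 1) ⟨y, hy⟩).symm.trans_le this
  have hνeq : ∫ x, g x ∂ν = P := le_antisymm (hintP ν hνp hν) hνP
  have heq : IsEquilibriumState f (Icc a b) φ (ν.map Subtype.val) := by
    refine ⟨invariantProb_map_val hf hν, ?_⟩
    rw [integral_map_val]
    refine le_antisymm (ksEntropy_add_integral_le_pressure hf hL hfL hφc hν) ?_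
    have h1 := ksEntropy_nonneg hf hL hfL hν
    change P ≤ _ + ∫ x, g x ∂ν
    linarith
  obtain ⟨Ψ, A, r, lam, M, far, hA, hΨ, hr, hlam, hΨν, hsh, hM1, hM, hfar⟩ := h ν hνp hν heq
  let ψ : Icc a b → ℝ := fun x => g x - P
  have hψc : Continuous ψ := hgc.sub continuous_const
  have hbψ : ∀ n x, birkhoffSum T ψ n x = birkhoffSum T g n x - P * n := by
    intro n x
    simp only [birkhoffSum, ψ, Finset.sum_sub_distrib, Finset.sum_const, Finset.card_range,
      nsmul_eq_mul]
    ring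
  have hgi : ∀ μ : Measure (Icc a b), IsProbabilityMeasure μ → ∫ x, ψ x ∂μ = ∫ x, g x ∂μ - P := by
    intro μ _
    have : Integrable g μ := hgc.integrable_of_hasCompactSupport (HasCompactSupport.of_compactSpace _)
    simp only [ψ]
    rw [integral_sub this (integrable_const _)]
    simp
  have hup : ∀ ε > 0, ∃ C, ∀ n x, birkhoffSum T ψ n x ≤ ε * n + C := by
    intro ε hε
    by_contra hcon
    push Not at hcon
    obtain ⟨S, hS⟩ := isCompact_univ.exists_bound_of_continuousOn hψc.continuousOn
    obtain ⟨μ, hμp, hμ, hμP⟩ := exists_invariant_of_birkhoffSum_ge hT hgc (c := P + ε) fun j => by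
      obtain ⟨n, x, hx⟩ := hcon (j * (|S| + 1))
      have hub : birkhoffSum T ψ n x ≤ n * |S| := by
        have : birkhoffSum T ψ n x ≤ ∑ _k ∈ Finset.range n, |S| :=
          Finset.sum_le_sum fun k _ => (le_abs_self _).trans
            ((hS _ (mem_univ _)).trans (le_abs_self S))
        simpa using this
      have hεn : 0 ≤ ε * n := by positivity
      have hS0 := abs_nonneg S
      refine ⟨n, ?_, x, ?_⟩
      · by_contra hle
        push Not at hle
        have hle' : (n:ℝ) ≤ j := by exact_mod_cast hle
        have := mul_le_mul_of_nonneg_right hle' hS0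
        have : (0:ℝ) ≤ j := Nat.cast_nonneg j
        nlinarith
      · rw [hbψ] at hx
        have : (0:ℝ) ≤ j * (|S| + 1) := by positivity
        linarith
    have := hintP μ hμp hμ
    linarith
  obtain ⟨N, m, hN, hm, J, hJc, hJd, hJ, β, hβ, hpos⟩ := exists_horseshoe_of_integral_pos hT hψc hα hC
    (fun x y => by simpa [ψ] using hg x y) hup hν (by rw [hgi ν hνp, hνeq, sub_self]) hA hΨ hr hlam
    hΨν hsh hM1 hM hfar
  obtain ⟨μ, hμp, hμ, ⟨q, hq, hent⟩, h_int⟩ :=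
    exists_measure_of_horseshoe hT hN hm hJc hJd hJ ⟨ψ, hψc⟩ β hβ
  have h1 := le_ksEntropy hf hL hfL hμ hm hq hent
  have h2 := ksEntropy_add_integral_le_pressure hf hL hfL hφc hμ
  have h3 : ∫ x, ψ x ∂μ = ∫ x : Icc a b, φ x ∂μ - P := hgi μ hμp
  simp only [ContinuousMap.coe_mk] at h_int
  have hNpos : (0:ℝ) < N := by exact_mod_cast hN
  have h4 : 0 < Real.log m / N + β / N := by rw [← add_div]; exact div_pos hpos hNpos
  linarith

end Reduction

open scoped Topology

section LocalStructure

theorem exists_bound_of_locally {K : Set ℝ} (hK : IsCompact K) {g W : ℝ → ℝ} (hW : ∀ x, 0 ≤ W x)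
    (h : ∀ p ∈ K, ∃ C, ∀ᶠ x in 𝓝[K] p, g x ≤ C * W x) : ∃ C, 0 < C ∧ ∀ x ∈ K, g x ≤ C * W x := by
  refine hK.induction_on (p := fun s => ∃ C, 0 < C ∧ ∀ x ∈ s, g x ≤ C * W x) ⟨1, by simp⟩ ?_ ?_ ?_
  · rintro s t hst ⟨C, hC, h⟩
    exact ⟨C, hC, fun x hx => h x (hst hx)⟩
  · rintro s t ⟨C, hC, h⟩ ⟨C', hC', h'⟩
    refine ⟨max C C', lt_max_of_lt_left hC, fun x hx => ?_⟩
    rcases hx with hx | hx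
    · exact (h x hx).trans (mul_le_mul_of_nonneg_right (le_max_left _ _) (hW x))
    · exact (h' x hx).trans (mul_le_mul_of_nonneg_right (le_max_right _ _) (hW x))
  · intro p hp
    obtain ⟨C, hC⟩ := h p hp
    refine ⟨_, hC, max C 1, by positivity, fun x hx => ?_⟩
    exact (show g x ≤ C * W x from hx).trans (mul_le_mul_of_nonneg_right (le_max_left _ _) (hW x))

variable {f : ℝ → ℝ} {a b : ℝ}

theorem continuousWithinAt_deriv_of_ne_zero (hf : IsC3NonflatIntervalMap f a b) {p : ℝ}
    (hp : p ∈ Icc a b) (hp0 : deriv f p ≠ 0) : ContinuousWithinAt (deriv f) (Icc a b) p := by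
  set F := {x | x ∈ Icc a b ∧ deriv f x = 0} with hF
  have hFc : IsOpen Fᶜ := hf.critFinite.isClosed.isOpen_compl
  have hset : Icc a b \ {x | deriv f x = 0} = Icc a b ∩ Fᶜ := by
    ext x; simp [hF]; tauto
  have hu : UniqueDiffOn ℝ (Icc a b ∩ Fᶜ) := (uniqueDiffOn_Icc hf.lt).inter hFc
  have hpF : p ∈ Fᶜ := fun h => hp0 h.2
  have hs := hf.smooth
  rw [hset] at hs
  have h1 := (hs.continuousOn_derivWithin hu (by norm_num)) p ⟨hp, hpF⟩
  have h2 : ContinuousWithinAt (deriv f) (Icc a b ∩ Fᶜ) p := by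
    refine h1.congr (fun x hx => ?_) ?_
    · exact ((hf.diff x hx.1).derivWithin (hu x hx)).symm
    · exact ((hf.diff p hp).derivWithin (hu p ⟨hp, hpF⟩)).symm
  exact (continuousWithinAt_inter (hFc.mem_nhds hpF)).1 h2

theorem tendsto_abs_sub_div {g : ℝ → ℝ} {p g' : ℝ} (hg : HasDerivAt g g' p) (s : Set ℝ) :
    Tendsto (fun x => |g x - g p| / |x - p|) (𝓝[s \ {p}] p) (𝓝 |g'|) := by
  have h1 := (hasDerivAt_iff_tendsto_slope.1 hg).abs
  refine (h1.mono_left (nhdsWithin_mono _ fun x hx => hx.2)).congr fun x => ?_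
  rw [slope_def_field, abs_div]

theorem exists_deriv_asymptotic (hf : IsC3NonflatIntervalMap f a b) {c : ℝ}
    (hc : c ∈ Icc a b) (hc0 : deriv f c = 0) :
    ∃ s > (0:ℝ), ∃ H > 0, Tendsto (fun x => |deriv f x| / |x - c| ^ s) (𝓝[Icc a b \ {c}] c) (𝓝 H) ∧
      ∃ H' > 0, Tendsto (fun x => |f x - f c| / |x - c| ^ (s + 1)) (𝓝[Icc a b \ {c}] c) (𝓝 H') := by
  obtain ⟨ℓ, hℓ, φ, ψ, hφ, hψ, hφc, hψc, hev⟩ := hf.nonflat c hc hc0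
  have hℓ0 : 0 < ℓ := by linarith
  have hφd : ∀ x, HasDerivAt φ (deriv φ x) x := fun x =>
    (hφ.1.differentiable (by norm_num) x).hasDerivAt
  have hψd : ∀ x, HasDerivAt ψ (deriv ψ x) x := fun x =>
    (hψ.1.differentiable (by norm_num) x).hasDerivAt
  have hφ0 : 0 < |deriv φ c| := abs_pos.2 (hφ.2.2 c)
  have hψ0 : 0 < |deriv ψ (f c)| := abs_pos.2 (hψ.2.2 _)
  have hfc : ContinuousAt f c := (hf.diff c hc).continuousAt
  have hle : 𝓝[Icc a b \ {c}] c ≤ 𝓝 c := nhdsWithin_le_nhds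
  have hφne : ∀ x, x ≠ c → φ x ≠ 0 := fun x hx h => hx (hφ.2.1.1 (h.trans hφc.symm))
  have hq : Tendsto (fun x => |φ x| / |x - c|) (𝓝[Icc a b \ {c}] c) (𝓝 |deriv φ c|) := by
    simpa [hφc] using tendsto_abs_sub_div (hφd c) (Icc a b)
  have hev' : ∀ᶠ x in 𝓝[Icc a b \ {c}] c, |ψ (f x)| = |φ x| ^ ℓ :=
    hev.filter_mono (nhdsWithin_mono _ sdiff_subset)
  have hmem : ∀ᶠ x in 𝓝[Icc a b \ {c}] c, x ∈ Icc a b \ {c} := self_mem_nhdsWithin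
  refine ⟨ℓ - 1, by linarith, ℓ * |deriv φ c| * |deriv φ c| ^ (ℓ - 1) / |deriv ψ (f c)|,
    by positivity, ?_, |deriv φ c| ^ ℓ / |deriv ψ (f c)|, by positivity, ?_⟩
  · have hlim : Tendsto (fun x => ℓ * |deriv φ x| * (|φ x| / |x - c|) ^ (ℓ - 1) / |deriv ψ (f x)|)
        (𝓝[Icc a b \ {c}] c) (𝓝 (ℓ * |deriv φ c| * |deriv φ c| ^ (ℓ - 1) / |deriv ψ (f c)|)) := by
      have h1 : Tendsto (fun x => |deriv φ x|) (𝓝[Icc a b \ {c}] c) (𝓝 |deriv φ c|) :=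
        ((hφ.1.continuous_deriv (by norm_num)).abs.tendsto c).mono_left hle
      have h2 : Tendsto (fun x => |deriv ψ (f x)|) (𝓝[Icc a b \ {c}] c) (𝓝 |deriv ψ (f c)|) :=
        (((hψ.1.continuous_deriv (by norm_num)).abs.tendsto (f c)).comp hfc).mono_left hle
      exact ((h1.const_mul ℓ).mul (hq.rpow_const (Or.inl hφ0.ne'))).div h2 hψ0.ne'
    refine hlim.congr' ?_
    have h_int : ∀ᶠ x in 𝓝[Icc a b \ {c}] c, ∀ᶠ z in 𝓝 x, |ψ (f z)| = |φ z| ^ ℓ := by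
      obtain ⟨δ, hδ, hball⟩ := Metric.mem_nhdsWithin_iff.1 hev
      rcases eq_or_lt_of_le hc.1 with rfl | hca
      · have hb : ∀ᶠ x in 𝓝[Icc a b \ {a}] a, x < b :=
          hle (gt_mem_nhds hf.lt)
        have hd : ∀ᶠ x in 𝓝[Icc a b \ {a}] a, x ∈ ball a δ := hle (ball_mem_nhds _ hδ)
        filter_upwards [hb, hd, hmem] with x hxb hxd hx
        have hxa : a < x := lt_of_le_of_ne hx.1.1 (Ne.symm hx.2)
        filter_upwards [isOpen_ball.mem_nhds hxd, Ioo_mem_nhds hxa hxb] with z hz1 hz2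
        exact hball ⟨hz1, Ioo_subset_Icc_self hz2⟩
      · have hb : ∀ᶠ x in 𝓝[Icc a b \ {c}] c, a < x := hle (lt_mem_nhds hca)
        have hd : ∀ᶠ x in 𝓝[Icc a b \ {c}] c, x ∈ ball c δ := hle (ball_mem_nhds _ hδ)
        have hb' : ∀ᶠ x in 𝓝[Icc a b \ {c}] c, x < b := by
          rcases eq_or_lt_of_le hc.2 with rfl | hcb
          · filter_upwards [hmem] with x hx using lt_of_le_of_ne hx.1.2 hx.2
          · exact hle (gt_mem_nhds hcb)
        filter_upwards [hb, hd, hb'] with x hxa hxd hxb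
        filter_upwards [isOpen_ball.mem_nhds hxd, Ioo_mem_nhds hxa hxb] with z hz1 hz2
        exact hball ⟨hz1, Ioo_subset_Icc_self hz2⟩
    filter_upwards [h_int, hev', hmem] with x hx hxe hxm
    have hxc : 0 < |x - c| := abs_pos.2 (sub_ne_zero.2 hxm.2)
    have hφx := hφne x hxm.2
    have hφx' : 0 < |φ x| := abs_pos.2 hφx
    have hψx' : 0 < |ψ (f x)| := by rw [hxe]; positivity
    have hψx : ψ (f x) ≠ 0 := abs_pos.1 hψx'
    have hfd : HasDerivAt f (deriv f x) x := (hf.diff x hxm.1).hasDerivAt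
    have d1 : HasDerivAt (fun z => Real.log (ψ (f z))) (deriv ψ (f x) * deriv f x / ψ (f x)) x :=
      ((hψd (f x)).comp x hfd).log hψx
    have d2 : HasDerivAt (fun z => ℓ * Real.log (φ z)) (ℓ * (deriv φ x / φ x)) x :=
      ((hφd x).log hφx).const_mul ℓ
    have heq : (fun z => Real.log (ψ (f z))) =ᶠ[𝓝 x] fun z => ℓ * Real.log (φ z) := by
      have hne : ∀ᶠ z in 𝓝 x, φ z ≠ 0 := (hφd x).continuousAt.eventually_ne hφx
      filter_upwards [hx, hne] with z hz hz0
      rw [← Real.log_abs, hz, Real.log_rpow (abs_pos.2 hz0), Real.log_abs]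
    have hder := (d2.congr_of_eventuallyEq heq).unique d1
    have habs := congrArg abs hder
    rw [abs_mul, abs_div, abs_div, abs_mul, abs_of_pos hℓ0, hxe] at habs
    have hψ' : 0 < |deriv ψ (f x)| := abs_pos.2 (hψ.2.2 _)
    have hpow : |φ x| ^ ℓ = |φ x| ^ (ℓ - 1) * |φ x| := by
      rw [← Real.rpow_add_one hφx'.ne']; congr 1; ring
    rw [hpow] at habs
    rw [Real.div_rpow hφx'.le hxc.le]
    have hp1 : 0 < |φ x| ^ (ℓ - 1) := by positivity
    have hp2 : 0 < |x - c| ^ (ℓ - 1) := by positivity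
    field_simp at habs ⊢
    rw [habs]
  · have hfne : ∀ᶠ x in 𝓝[Icc a b \ {c}] c, f x ≠ f c := by
      filter_upwards [hev', hmem] with x hxe hxm h
      rw [h, hψc, abs_zero] at hxe
      have : 0 < |φ x| := abs_pos.2 (hφne x hxm.2)
      have : 0 < |φ x| ^ ℓ := by positivity
      linarith
    have hψq : Tendsto (fun x => |ψ (f x)| / |f x - f c|) (𝓝[Icc a b \ {c}] c)
        (𝓝 |deriv ψ (f c)|) := by
      have h1 : Tendsto (fun z => |ψ z| / |z - f c|) (𝓝[univ \ {f c}] (f c)) (𝓝 |deriv ψ (f c)|) := by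
        simpa [hψc] using tendsto_abs_sub_div (hψd (f c)) univ
      refine h1.comp (tendsto_nhdsWithin_iff.2 ⟨hfc.tendsto.mono_left hle, ?_⟩)
      filter_upwards [hfne] with x hx using ⟨mem_univ _, hx⟩
    have hlim := (hq.rpow_const (p := ℓ) (Or.inl hφ0.ne')).div hψq hψ0.ne'
    refine hlim.congr' ?_
    filter_upwards [hev', hfne, hmem] with x hxe hxf hxm
    have hxc : 0 < |x - c| := abs_pos.2 (sub_ne_zero.2 hxm.2)
    have hφx' : 0 < |φ x| := abs_pos.2 (hφne x hxm.2)
    have hfx' : 0 < |f x - f c| := abs_pos.2 (sub_ne_zero.2 hxf)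
    rw [Pi.div_apply, hxe, Real.div_rpow hφx'.le hxc.le, sub_add_cancel]
    have hp1 : 0 < |φ x| ^ ℓ := by positivity
    have hp2 : 0 < |x - c| ^ ℓ := by positivity
    field_simp

end LocalStructure

section Exactness

variable {f : ℝ → ℝ} {a b : ℝ}

theorem exists_abs_deriv_le (hf : IsC3NonflatIntervalMap f a b) :
    ∃ L, 1 ≤ L ∧ ∀ x ∈ Icc a b, |deriv f x| ≤ L := by
  obtain ⟨C, hC, h⟩ := exists_bound_of_locally isCompact_Icc (g := fun x => |deriv f x|)
    (W := fun _ => 1) (fun _ => zero_le_one) fun p hp => by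
      by_cases hp0 : deriv f p = 0
      · obtain ⟨s, hs, H, hH, hlim, -⟩ := exists_deriv_asymptotic hf hp hp0
        have hev := hlim.eventually (gt_mem_nhds (lt_add_one H))
        refine ⟨(H + 1) * (b - a) ^ s, ?_⟩
        rw [eventually_nhdsWithin_iff] at hev ⊢
        filter_upwards [hev] with x hx hxI
        rw [mul_one]
        by_cases hxp : x = p
        · rw [hxp, hp0, abs_zero]
          have := hf.lt
          have : 0 < b - a := by linarith
          positivity
        · have h1 := hx ⟨hxI, hxp⟩
          have h2 : 0 < |x - p| := abs_pos.2 (sub_ne_zero.2 hxp)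
          rw [div_lt_iff₀ (by positivity)] at h1
          refine h1.le.trans (mul_le_mul_of_nonneg_left (Real.rpow_le_rpow h2.le ?_ hs.le)
            (by positivity))
          rw [abs_le]
          constructor <;> linarith [hxI.1, hxI.2, hp.1, hp.2]
      · refine ⟨|deriv f p| + 1, ?_⟩
        filter_upwards [(continuousWithinAt_deriv_of_ne_zero hf hp hp0).abs.eventually
          (gt_mem_nhds (lt_add_one _))] with x hx
        rw [mul_one]
        exact le_of_lt hx
  exact ⟨max C 1, le_max_right _ _, fun x hx =>
    ((h x hx).trans_eq (mul_one C)).trans (le_max_left _ _)⟩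

theorem abs_sub_le_of_deriv_le (hf : IsC3NonflatIntervalMap f a b) {L : ℝ}
    (hL : ∀ x ∈ Icc a b, |deriv f x| ≤ L) :
    ∀ x ∈ Icc a b, ∀ y ∈ Icc a b, |f x - f y| ≤ L * |x - y| := fun _ hx _ hy =>
  (convex_Icc a b).norm_image_sub_le_of_norm_deriv_le (fun z hz => hf.diff z hz) hL hy hx

theorem TopExact.surjOn (hex : TopExact f (Icc a b)) (hf : MapsTo f (Icc a b) (Icc a b)) :
    f '' Icc a b = Icc a b := by
  rcases (Icc a b).eq_empty_or_nonempty with h | h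
  · simp [h]
  obtain ⟨n, hn, himg⟩ := hex univ isOpen_univ (by simpa using h)
  rw [univ_inter] at himg
  obtain ⟨n, rfl⟩ := Nat.exists_eq_add_of_le' hn
  refine (image_subset_iff.2 hf).antisymm ?_
  rw [Function.iterate_succ', image_comp] at himg
  exact himg.symm.subset.trans (image_mono (image_subset_iff.2 (hf.iterate n)))

theorem image_iterate_eq (h : f '' Icc a b = Icc a b) (n : ℕ) : f^[n] '' Icc a b = Icc a b := by
  induction n with
  | zero => simp
  | succ n ih => rw [Function.iterate_succ, image_comp, h, ih]

theorem TopExact.exists_uniform (hex : TopExact f (Icc a b)) (hf : MapsTo f (Icc a b) (Icc a b))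
    {r : ℝ} (hr : 0 < r) : ∃ M, 1 ≤ M ∧ ∀ y z : Icc a b, ∃ v : Icc a b, dist v y ≤ r ∧
      (hf.restrict f _ _)^[M] v = z := by
  have key : ∃ M, ∀ m ≥ M, ∀ y ∈ Icc a b, ∀ z ∈ Icc a b, ∃ v ∈ Icc a b, |v - y| ≤ r ∧
      f^[m] v = z := by
    refine isCompact_Icc.induction_on (p := fun s => ∃ M, ∀ m ≥ M, ∀ y ∈ s, ∀ z ∈ Icc a b,
      ∃ v ∈ Icc a b, |v - y| ≤ r ∧ f^[m] v = z) ⟨0, by simp⟩ ?_ ?_ ?_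
    · rintro s t hst ⟨M, hM⟩
      exact ⟨M, fun m hm y hy => hM m hm y (hst hy)⟩
    · rintro s t ⟨M, hM⟩ ⟨M', hM'⟩
      refine ⟨max M M', fun m hm y hy => ?_⟩
      rcases hy with hy | hy
      · exact hM m ((le_max_left _ _).trans hm) y hy
      · exact hM' m ((le_max_right _ _).trans hm) y hy
    · intro q hq
      obtain ⟨n, hn, himg⟩ := hex (ball q (r / 2)) isOpen_ball ⟨q, mem_ball_self (by positivity), hq⟩
      refine ⟨ball q (r / 2), mem_nhdsWithin_of_mem_nhds (ball_mem_nhds _ (by positivity)), n,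
        fun m hm y hy z hz => ?_⟩
      have h1 : f^[m] '' (ball q (r / 2) ∩ Icc a b) = Icc a b := by
        conv_lhs => rw [← Nat.sub_add_cancel hm, Function.iterate_add, image_comp, himg]
        exact image_iterate_eq (hex.surjOn hf) _
      rw [← h1] at hz
      obtain ⟨v, hv, rfl⟩ := hz
      refine ⟨v, hv.2, ?_, rfl⟩
      have h2 := mem_ball.1 hy
      have h3 := mem_ball.1 hv.1
      have h4 := dist_triangle_right v y q
      rw [← Real.dist_eq]
      linarith
  obtain ⟨M, hM⟩ := key
  refine ⟨max M 1, le_max_right _ _, fun y z => ?_⟩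
  obtain ⟨v, hv, hvy, hvz⟩ := hM _ (le_max_left M 1) y y.2 z z.2
  exact ⟨⟨v, hv⟩, hvy, Subtype.ext (by rw [coe_iterate_restrict]; exact hvz)⟩

theorem TopExact.iterate_ne_of_deriv_eq_zero (hex : TopExact f (Icc a b))
    (hf : IsC3NonflatIntervalMap f a b) {c : ℝ} (hc : c ∈ Icc a b) (hc0 : deriv f c = 0) {n : ℕ}
    (hn : 1 ≤ n) : f^[n] c ≠ c := by
  intro hfix
  obtain ⟨L, hL1, hL⟩ := exists_abs_deriv_le hf
  have hlip := abs_sub_le_of_deriv_le hf hL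
  have hLpos : 0 < L := by linarith
  have hab := hf.lt
  have hiter : ∀ n, ∀ x ∈ Icc a b, ∀ y ∈ Icc a b, |f^[n] x - f^[n] y| ≤ L ^ n * |x - y| := by
    intro n
    induction n with
    | zero => intro x _ y _; simp
    | succ n ih =>
      intro x hx y hy
      rw [Function.iterate_succ_apply, Function.iterate_succ_apply, pow_succ, mul_assoc]
      exact (ih _ (hf.mapsTo hx) _ (hf.mapsTo hy)).trans
        (mul_le_mul_of_nonneg_left (hlip x hx y hy) (by positivity))
  have hder : HasDerivAt f 0 c := hc0 ▸ (hf.diff c hc).hasDerivAt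
  have ho := (hasDerivAt_iff_isLittleO.1 hder).def (c := 1 / (2 * L ^ n)) (by positivity)
  obtain ⟨δ, hδ, hball⟩ := Metric.eventually_nhds_iff.1 ho
  set δ' := min δ ((b - a) / 2) with hδ'
  have hδ'pos : 0 < δ' := lt_min hδ (by linarith)
  set U := ball c δ' with hU
  have hmaps : MapsTo f^[n] (U ∩ Icc a b) (U ∩ Icc a b) := by
    rintro x ⟨hx, hxI⟩
    refine ⟨?_, hf.mapsTo.iterate n hxI⟩
    have h1 := hball ((mem_ball.1 hx).trans_le (min_le_left _ _))
    simp only [smul_zero, sub_zero, Real.norm_eq_abs] at h1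
    obtain ⟨n, rfl⟩ := Nat.exists_eq_add_of_le' hn
    have h2 := hiter n (f x) (hf.mapsTo hxI) (f c) (hf.mapsTo hc)
    rw [← Function.iterate_succ_apply, ← Function.iterate_succ_apply, hfix] at h2
    have h3 : L ^ n ≤ L ^ (n + 1) := pow_le_pow_right₀ hL1 (Nat.le_succ n)
    have h4 : L ^ n * |f x - f c| ≤ L ^ (n + 1) * (1 / (2 * L ^ (n + 1)) * |x - c|) :=
      mul_le_mul h3 h1 (abs_nonneg _) (by positivity)
    have h5 : L ^ (n + 1) * (1 / (2 * L ^ (n + 1)) * |x - c|) = |x - c| / 2 := by field_simp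
    rw [mem_ball, Real.dist_eq]
    have h6 := mem_ball.1 hx
    rw [Real.dist_eq] at h6
    have := abs_nonneg (x - c)
    linarith
  obtain ⟨N, hN, himg⟩ := hex U isOpen_ball ⟨c, mem_ball_self hδ'pos, hc⟩
  have h1 : f^[n * N] '' (U ∩ Icc a b) = Icc a b := by
    have : n * N = (n - 1) * N + N := by
      obtain ⟨n, rfl⟩ := Nat.exists_eq_add_of_le' hn
      rw [Nat.add_sub_cancel]; ring
    rw [this, Function.iterate_add, image_comp, himg]
    exact image_iterate_eq (hex.surjOn hf.mapsTo) _
  have h2 : f^[n * N] '' (U ∩ Icc a b) ⊆ U := by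
    rw [Function.iterate_mul]
    exact (image_subset_iff.2 (hmaps.iterate N)).trans inter_subset_left
  rw [h1] at h2
  have ha := mem_ball.1 (h2 (left_mem_Icc.2 hab.le))
  have hb := mem_ball.1 (h2 (right_mem_Icc.2 hab.le))
  have h3 := dist_triangle_right b a c
  have h4 : dist b a = b - a := by rw [Real.dist_eq, abs_of_pos (by linarith)]
  have h5 : δ' ≤ (b - a) / 2 := min_le_right _ _
  linarith

theorem exists_le_abs_sub (hf : IsC3NonflatIntervalMap f a b) {p : ℝ} (hp : p ∈ Icc a b) :
    ∃ k > 0, ∃ s ≥ (0:ℝ), ∀ᶠ x in 𝓝[Icc a b \ {p}] p, k * |x - p| ^ s ≤ |f x - f p| := by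
  have main : ∃ H > 0, ∃ s ≥ (0:ℝ),
      Tendsto (fun x => |f x - f p| / |x - p| ^ s) (𝓝[Icc a b \ {p}] p) (𝓝 H) := by
    by_cases hp0 : deriv f p = 0
    · obtain ⟨s, hs, _, _, _, H, hH, hlim⟩ := exists_deriv_asymptotic hf hp hp0
      exact ⟨H, hH, s + 1, by linarith, hlim⟩
    · refine ⟨_, abs_pos.2 hp0, 1, zero_le_one, ?_⟩
      simpa using tendsto_abs_sub_div (hf.diff p hp).hasDerivAt (Icc a b)
  obtain ⟨H, hH, s, hs, hlim⟩ := main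
  refine ⟨H / 2, by positivity, s, hs, ?_⟩
  filter_upwards [hlim.eventually (lt_mem_nhds (half_lt_self hH)), self_mem_nhdsWithin] with x hx hxm
  have : 0 < |x - p| := abs_pos.2 (sub_ne_zero.2 hxm.2)
  exact ((lt_div_iff₀ (by positivity)).1 hx).le

end Exactness

section Singularities

/-- The nonnegative logarithmic distance of `x` to `p`. -/
def logDist (p x : ℝ) : ℝ := max 0 (-Real.log |x - p|)

theorem logDist_nonneg (p x : ℝ) : 0 ≤ logDist p x := le_max_left _ _

theorem measurable_logDist (p : ℝ) : Measurable (logDist p) :=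
  measurable_const.max (Real.measurable_log.comp
    (continuous_abs.measurable.comp (measurable_id.sub_const p))).neg

variable {f : ℝ → ℝ} {a b : ℝ}

/-- The measure `ν` does not charge `p` and the logarithmic distance to `p` is integrable. -/
def LogTame (ν : Measure (Icc a b)) (p : ℝ) : Prop :=
  (∀ᵐ x : Icc a b ∂ν, (x : ℝ) ≠ p) ∧ Integrable (fun x : Icc a b => logDist p x) ν

theorem exists_abs_deriv_le_rpow (hf : IsC3NonflatIntervalMap f a b) {c : ℝ}
    (hc : c ∈ Icc a b) (hc0 : deriv f c = 0) :
    ∃ s > (0:ℝ), ∃ A > 0, ∀ x ∈ Icc a b, |deriv f x| ≤ A * |x - c| ^ s := by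
  obtain ⟨L, hL1, hL⟩ := exists_abs_deriv_le hf
  obtain ⟨s, hs, H, hH, hlim, -⟩ := exists_deriv_asymptotic hf hc hc0
  refine ⟨s, hs, exists_bound_of_locally isCompact_Icc (fun x => by positivity) fun p hp => ?_⟩
  by_cases hpc : p = c
  · subst hpc
    have hev := hlim.eventually (gt_mem_nhds (lt_add_one H))
    refine ⟨H + 1, ?_⟩
    rw [eventually_nhdsWithin_iff] at hev ⊢
    filter_upwards [hev] with x hx hxI
    by_cases hxp : x = p
    · rw [hxp, hc0, abs_zero]
      positivity
    · have h2 : 0 < |x - p| := abs_pos.2 (sub_ne_zero.2 hxp)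
      exact ((div_lt_iff₀ (by positivity)).1 (hx ⟨hxI, hxp⟩)).le
  · have hd : 0 < |p - c| := abs_pos.2 (sub_ne_zero.2 hpc)
    have hcont : Tendsto (fun x => |x - c|) (𝓝[Icc a b] p) (𝓝 |p - c|) :=
      ((continuous_abs.comp (continuous_sub_right c)).tendsto p).mono_left nhdsWithin_le_nhds
    refine ⟨L / (|p - c| / 2) ^ s, ?_⟩
    filter_upwards [hcont.eventually (lt_mem_nhds (half_lt_self hd)), self_mem_nhdsWithin]
      with x hx hxI
    have h1 : (|p - c| / 2) ^ s ≤ |x - c| ^ s := Real.rpow_le_rpow (by positivity) hx.le hs.le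
    have h2 : 0 < (|p - c| / 2) ^ s := by positivity
    calc |deriv f x| ≤ L := hL x hxI
      _ = L / (|p - c| / 2) ^ s * (|p - c| / 2) ^ s := by field_simp
      _ ≤ _ := mul_le_mul_of_nonneg_left h1 (by positivity)

variable {ν : Measure (Icc a b)}

theorem ae_ne_of_iterate_ne [IsFiniteMeasure ν] {T : Icc a b → Icc a b}
    (hT : MeasurePreserving T ν ν) {c : Icc a b} (h : ∀ n, 1 ≤ n → T^[n] c ≠ c) :
    ∀ᵐ x : Icc a b ∂ν, x ≠ c := by
  rw [ae_iff]
  by_contra h0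
  obtain ⟨x, hx, m, hm, hmx⟩ := hT.exists_mem_iterate_mem
    (s := {x | ¬ x ≠ c}) (by
      simp only [not_not, ofPred_eq_eq_singleton, measurableSet_singleton,
        MeasurableSet.nullMeasurableSet]) h0
  simp only [not_not, mem_ofPred_eq] at hx hmx
  rw [hx] at hmx
  exact h m (Nat.one_le_iff_ne_zero.2 hm) hmx

theorem ae_deriv_ne_zero [IsFiniteMeasure ν] (hf : IsC3NonflatIntervalMap f a b)
    (hex : TopExact f (Icc a b)) (hT : MeasurePreserving (hf.mapsTo.restrict f _ _) ν ν) :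
    ∀ᵐ x : Icc a b ∂ν, deriv f x ≠ 0 := by
  have h : ∀ᵐ x : Icc a b ∂ν, ∀ c ∈ {x | x ∈ Icc a b ∧ deriv f x = 0}, (x : ℝ) ≠ c := by
    rw [ae_ball_iff hf.critFinite.countable]
    rintro c ⟨hc, hc0⟩
    have h1 := ae_ne_of_iterate_ne hT (c := ⟨c, hc⟩) fun n hn h => by
      have h2 := congrArg Subtype.val h
      rw [coe_iterate_restrict] at h2
      exact hex.iterate_ne_of_deriv_eq_zero hf hc hc0 hn h2
    filter_upwards [h1] with x hx hxc using hx (Subtype.ext hxc)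
  filter_upwards [h] with x hx hx0 using hx x ⟨x.2, hx0⟩ rfl

theorem logTame_of_deriv_eq_zero [IsFiniteMeasure ν] (hf : IsC3NonflatIntervalMap f a b)
    (hex : TopExact f (Icc a b)) (hT : MeasurePreserving (hf.mapsTo.restrict f _ _) ν ν)
    (h_int : Integrable (fun x : Icc a b => Real.log |deriv f x|) ν) {c : ℝ}
    (hc : c ∈ Icc a b) (hc0 : deriv f c = 0) : LogTame ν c := by
  have hne := ae_deriv_ne_zero hf hex hT
  refine ⟨by filter_upwards [hne] with x hx hxc using hx (hxc ▸ hc0), ?_⟩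
  obtain ⟨s, hs, A, hA, hbound⟩ := exists_abs_deriv_le_rpow hf hc hc0
  refine Integrable.mono' (((integrable_const |Real.log A|).add h_int.abs).div_const s)
    ((measurable_logDist c).comp measurable_subtype_coe).aestronglyMeasurable ?_
  filter_upwards [hne] with x hx
  rw [Real.norm_of_nonneg (logDist_nonneg _ _)]
  simp only [Pi.add_apply]
  refine max_le (by positivity) ?_
  have hxc : 0 < |(x : ℝ) - c| := abs_pos.2 (sub_ne_zero.2 fun h => hx (h ▸ hc0))
  have h1 := Real.log_le_log (abs_pos.2 hx) (hbound x x.2)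
  rw [Real.log_mul hA.ne' (by positivity), Real.log_rpow hxc] at h1
  rw [le_div_iff₀ hs]
  linarith [le_abs_self (Real.log A), neg_abs_le (Real.log |deriv f x|)]

theorem exists_logDist_comp_le (hf : IsC3NonflatIntervalMap f a b) {e : ℝ} {F : Finset ℝ}
    (hF : ∀ x ∈ Icc a b, f x = e → x ∈ F) :
    ∃ C > 0, ∀ x ∈ Icc a b, x ∉ F → logDist e (f x) ≤ C * (1 + ∑ p ∈ F, logDist p x) := by
  classical
  have hW : ∀ x, 0 ≤ 1 + ∑ p ∈ F, logDist p x := fun x =>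
    add_nonneg zero_le_one (Finset.sum_nonneg fun p _ => logDist_nonneg p x)
  obtain ⟨C, hC, h⟩ := exists_bound_of_locally (K := Icc a b) isCompact_Icc
    (g := fun x => if x ∈ F then 0 else logDist e (f x)) hW fun p hp => by
      by_cases hpe : f p = e
      · have hpF := hF p hp hpe
        obtain ⟨k, hk, s, hs, hev⟩ := exists_le_abs_sub hf hp
        refine ⟨|Real.log k| + s, ?_⟩
        rw [eventually_nhdsWithin_iff] at hev ⊢
        filter_upwards [hev] with x hx hxI
        split_ifs with hxF
        · exact mul_nonneg (by positivity) (hW x)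
        have hxp : x ≠ p := fun h => hxF (h ▸ hpF)
        have hd : 0 < |x - p| := abs_pos.2 (sub_ne_zero.2 hxp)
        have h1 := Real.log_le_log (by positivity) (hx ⟨hxI, hxp⟩)
        rw [Real.log_mul hk.ne' (by positivity), Real.log_rpow hd, hpe] at h1
        have h2 : logDist p x ≤ ∑ p ∈ F, logDist p x :=
          Finset.single_le_sum (fun p _ => logDist_nonneg p x) hpF
        have h3 : -Real.log |x - p| ≤ ∑ p ∈ F, logDist p x := (le_max_right _ _).trans h2
        have h4 := mul_le_mul_of_nonneg_left h3 hs
        have h5 := (logDist_nonneg p x).trans h2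
        refine max_le (mul_nonneg (by positivity) (hW x)) ?_
        have := neg_abs_le (Real.log k)
        have := mul_nonneg (abs_nonneg (Real.log k)) h5
        nlinarith
      · have hd : 0 < |f p - e| := abs_pos.2 (sub_ne_zero.2 hpe)
        have hcont : Tendsto (fun x => |f x - e|) (𝓝[Icc a b] p) (𝓝 |f p - e|) :=
          (((hf.diff p hp).continuousAt.tendsto.sub_const e).abs).mono_left nhdsWithin_le_nhds
        refine ⟨|Real.log (|f p - e| / 2)|, ?_⟩
        filter_upwards [hcont.eventually (lt_mem_nhds (half_lt_self hd))] with x hx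
        split_ifs with hxF
        · exact mul_nonneg (by positivity) (hW x)
        refine max_le (mul_nonneg (by positivity) (hW x)) ?_
        have h1 := Real.log_le_log (by positivity) hx.le
        have h2 := neg_abs_le (Real.log (|f p - e| / 2))
        have h3 : 0 ≤ ∑ p ∈ F, logDist p x := Finset.sum_nonneg fun p _ => logDist_nonneg p x
        have h4 := mul_nonneg (abs_nonneg (Real.log (|f p - e| / 2))) h3
        linarith
  exact ⟨C, hC, fun x hx hxF => by simpa [hxF] using h x hx⟩

theorem logTame_of_preimage [IsFiniteMeasure ν] (hf : IsC3NonflatIntervalMap f a b)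
    (hT : MeasurePreserving (hf.mapsTo.restrict f _ _) ν ν) {e : ℝ} {F : Finset ℝ}
    (hF : ∀ x ∈ Icc a b, f x = e → x ∈ F) (htame : ∀ p ∈ F, LogTame ν p) : LogTame ν e := by
  obtain ⟨C, hC, hbound⟩ := exists_logDist_comp_le hf hF
  have hne : ∀ᵐ x : Icc a b ∂ν, ∀ p ∈ (F : Set ℝ), (x : ℝ) ≠ p := by
    rw [ae_ball_iff F.countable_toSet]
    exact fun p hp => (htame p hp).1
  have hnF : ∀ᵐ x : Icc a b ∂ν, (x : ℝ) ∉ F := by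
    filter_upwards [hne] with x hx hxF using hx x hxF rfl
  constructor
  · have hms : MeasurableSet {x : Icc a b | ¬ (x : ℝ) ≠ e} := by
      simp only [not_not]
      exact measurable_subtype_coe (measurableSet_singleton e)
    rw [ae_iff, ← hT.measure_preimage hms.nullMeasurableSet, ← nonpos_iff_eq_zero]
    refine (measure_mono fun x hx => ?_).trans_eq (ae_iff.1 hnF)
    simp only [not_not, mem_preimage, mem_ofPred_eq] at hx ⊢
    exact hF x x.2 hx
  · have hmeas : Measurable fun x : Icc a b => logDist e x :=
      (measurable_logDist e).comp measurable_subtype_coe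
    rw [← hT.integrable_comp hmeas.aestronglyMeasurable]
    refine Integrable.mono' (((integrable_const (1 : ℝ)).add
      (integrable_finsetSum F fun p hp => (htame p hp).2)).const_mul C)
      (hmeas.comp hT.measurable).aestronglyMeasurable ?_
    filter_upwards [hnF] with x hx
    rw [Function.comp_apply, Real.norm_of_nonneg (logDist_nonneg _ _)]
    exact hbound x x.2 hx

theorem deriv_eq_zero_of_mem_Ioo (hf : MapsTo f (Icc a b) (Icc a b)) {x : ℝ} (hx : x ∈ Ioo a b)
    (h : f x = a ∨ f x = b) : deriv f x = 0 := by
  have hev : ∀ᶠ y in 𝓝 x, f y ∈ Icc a b := by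
    filter_upwards [Icc_mem_nhds hx.1 hx.2] with y hy using hf hy
  rcases h with h | h
  · refine IsLocalMin.deriv_eq_zero ?_
    filter_upwards [hev] with y hy using h ▸ hy.1
  · refine IsLocalMax.deriv_eq_zero ?_
    filter_upwards [hev] with y hy using h ▸ hy.2

theorem exists_singular_set [IsFiniteMeasure ν] (hf : IsC3NonflatIntervalMap f a b)
    (hex : TopExact f (Icc a b)) (hT : MeasurePreserving (hf.mapsTo.restrict f _ _) ν ν)
    (h_int : Integrable (fun x : Icc a b => Real.log |deriv f x|) ν) :
    ∃ S : Finset ℝ, (∀ p ∈ S, LogTame ν p) ∧ (∀ x ∈ Icc a b, deriv f x = 0 → x ∈ S) ∧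
      ∀ e, e = a ∨ e = b → e ∉ S → f e = a ∨ f e = b := by
  classical
  set F := hf.critFinite.toFinset with hFdef
  have hmemF : ∀ x, x ∈ F ↔ x ∈ Icc a b ∧ deriv f x = 0 := fun x => by simp [hFdef]
  have htF : ∀ p ∈ F, LogTame ν p := fun p hp =>
    logTame_of_deriv_eq_zero hf hex hT h_int ((hmemF p).1 hp).1 ((hmemF p).1 hp).2
  have hab := hf.lt
  have key : ∀ e e', (e = a ∧ e' = b ∨ e = b ∧ e' = a) → ¬ (f e = a ∨ f e = b) →
      LogTame ν e := by
    intro e e' hee hbad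
    have hpre : ∀ d, (d = a ∨ d = b) → ∀ x ∈ Icc a b, f x = d → x ∉ F → x = e' := by
      intro d hd x hx hxd hxF
      by_contra hne
      have hfx : f x = a ∨ f x = b := by rcases hd with rfl | rfl <;> simp [hxd]
      have hxe : x ≠ e := fun h => hbad (h ▸ hfx)
      have hxa : x ≠ a := by rcases hee with ⟨rfl, rfl⟩ | ⟨rfl, rfl⟩ <;> assumption
      have hxb : x ≠ b := by rcases hee with ⟨rfl, rfl⟩ | ⟨rfl, rfl⟩ <;> assumption
      exact hxF ((hmemF x).2 ⟨hx, deriv_eq_zero_of_mem_Ioo hf.mapsTo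
        ⟨lt_of_le_of_ne hx.1 (Ne.symm hxa), lt_of_le_of_ne hx.2 hxb⟩ hfx⟩)
    have he : e = a ∨ e = b := by tauto
    have he' : e' = a ∨ e' = b := by tauto
    have hne : e ≠ e' := by
      rcases hee with ⟨rfl, rfl⟩ | ⟨rfl, rfl⟩
      exacts [hab.ne, hab.ne']
    by_cases hfe : f e' = e
    · have h1 : LogTame ν e' := by
        refine logTame_of_preimage hf hT (F := F) (fun x hx hxe => ?_) htF
        by_contra hxF
        have := hpre e' he' x hx hxe hxF
        rw [this, hfe] at hxe
        exact hne hxe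
      refine logTame_of_preimage hf hT (F := insert e' F) (fun x hx hxe => ?_) fun p hp => ?_
      · by_cases hxF : x ∈ F
        · exact Finset.mem_insert_of_mem hxF
        · exact Finset.mem_insert.2 (Or.inl (hpre e he x hx hxe hxF))
      · rcases Finset.mem_insert.1 hp with rfl | hp
        exacts [h1, htF p hp]
    · refine logTame_of_preimage hf hT (F := F) (fun x hx hxe => ?_) htF
      by_contra hxF
      exact hfe (hpre e he x hx hxe hxF ▸ hxe)
  refine ⟨F ∪ ({a, b} : Finset ℝ).filter fun e => ¬ (f e = a ∨ f e = b), fun p hp => ?_,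
    fun x hx hx0 => Finset.mem_union_left _ ((hmemF x).2 ⟨hx, hx0⟩), fun e he heS => ?_⟩
  · rcases Finset.mem_union.1 hp with hp | hp
    · exact htF p hp
    · obtain ⟨hp, hbad⟩ := Finset.mem_filter.1 hp
      rw [Finset.mem_insert, Finset.mem_singleton] at hp
      rcases hp with rfl | rfl
      · exact key _ _ (Or.inl ⟨rfl, rfl⟩) hbad
      · exact key _ _ (Or.inr ⟨rfl, rfl⟩) hbad
  · by_contra hbad
    refine heS (Finset.mem_union_right _ (Finset.mem_filter.2 ⟨?_, hbad⟩))
    rcases he with rfl | rfl <;> simp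

end Singularities

section Pullback

/-- The total logarithmic distance to a finite set. -/
def logDistSum (S : Finset ℝ) (x : ℝ) : ℝ := ∑ p ∈ S, logDist p x

theorem logDistSum_nonneg (S : Finset ℝ) (x : ℝ) : 0 ≤ logDistSum S x :=
  Finset.sum_nonneg fun p _ => logDist_nonneg p x

theorem exp_neg_logDistSum_le_one (S : Finset ℝ) (x : ℝ) : Real.exp (-logDistSum S x) ≤ 1 :=
  Real.exp_le_one_iff.2 (neg_nonpos.2 (logDistSum_nonneg S x))

theorem exp_neg_logDistSum_le {S : Finset ℝ} {p x : ℝ} (hp : p ∈ S) (hx : x ∉ S) :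
    Real.exp (-logDistSum S x) ≤ |x - p| := by
  have hd : 0 < |x - p| := abs_pos.2 (sub_ne_zero.2 fun h => hx (h ▸ hp))
  rw [← Real.le_log_iff_exp_le hd]
  have h1 : logDist p x ≤ logDistSum S x :=
    Finset.single_le_sum (fun p _ => logDist_nonneg p x) hp
  have h2 : -Real.log |x - p| ≤ logDist p x := le_max_right _ _
  linarith

variable {f : ℝ → ℝ} {a b : ℝ}

theorem exists_distortion (hf : IsC3NonflatIntervalMap f a b) {S : Finset ℝ}
    (hS : ∀ x ∈ Icc a b, deriv f x = 0 → x ∈ S) {η : ℝ} (hη : 0 < η) :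
    ∃ κ, 0 < κ ∧ κ < 1 ∧ ∀ y ∈ Icc a b, y ∉ S → ∀ v ∈ Icc a b,
      |v - y| ≤ κ * Real.exp (-logDistSum S y) → Real.exp (-η) * |deriv f y| ≤ |deriv f v| := by
  refine isCompact_Icc.induction_on (p := fun s => ∃ κ, 0 < κ ∧ κ < 1 ∧ ∀ y ∈ s, y ∉ S →
    ∀ v ∈ Icc a b, |v - y| ≤ κ * Real.exp (-logDistSum S y) →
      Real.exp (-η) * |deriv f y| ≤ |deriv f v|) ⟨1 / 2, by norm_num, by norm_num, by simp⟩ ?_ ?_ ?_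
  · rintro s t hst ⟨κ, h0, h1, h⟩
    exact ⟨κ, h0, h1, fun y hy => h y (hst hy)⟩
  · rintro s t ⟨κ, h0, h1, h⟩ ⟨κ', h0', h1', h'⟩
    refine ⟨min κ κ', lt_min h0 h0', (min_le_left _ _).trans_lt h1, fun y hy hyS v hv hvy => ?_⟩
    rcases hy with hy | hy
    · exact h y hy hyS v hv (hvy.trans
        (mul_le_mul_of_nonneg_right (min_le_left _ _) (Real.exp_pos _).le))
    · exact h' y hy hyS v hv (hvy.trans
        (mul_le_mul_of_nonneg_right (min_le_right _ _) (Real.exp_pos _).le))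
  · intro p hp
    have hball : ∀ δ κ y v : ℝ, κ ≤ δ / 2 → 0 < κ → y ∈ ball p (δ / 2) →
        |v - y| ≤ κ * Real.exp (-logDistSum S y) → v ∈ ball p δ := by
      intro δ κ y v hκ hκ0 hy hvy
      have h1 := exp_neg_logDistSum_le_one S y
      have h2 : κ * Real.exp (-logDistSum S y) ≤ κ * 1 := mul_le_mul_of_nonneg_left h1 hκ0.le
      have h3 := mem_ball.1 hy
      have h4 := dist_triangle v y p
      rw [← Real.dist_eq] at hvy
      rw [mem_ball]
      linarith
    by_cases hp0 : deriv f p = 0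
    · have hpS := hS p hp hp0
      obtain ⟨s, hs, H, hH, hlim, -⟩ := exists_deriv_asymptotic hf hp hp0
      have he1 : Real.exp (-(η / 4)) * H < H :=
        mul_lt_of_lt_one_left hH (Real.exp_lt_one_iff.2 (by linarith))
      have he2 : H < Real.exp (η / 4) * H :=
        lt_mul_of_one_lt_left hH (Real.one_lt_exp_iff.2 (by linarith))
      obtain ⟨δ, hδ, hsub⟩ := Metric.mem_nhdsWithin_iff.1
        (hlim.eventually (Ioo_mem_nhds he1 he2))
      set κ₀ := 1 - Real.exp (-(η / (2 * s))) with hκ₀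
      have hκ₀pos : 0 < κ₀ := sub_pos.2 (Real.exp_lt_one_iff.2 (neg_neg_of_pos (by positivity)))
      refine ⟨ball p (δ / 2) ∩ Icc a b, inter_comm (Icc a b) _ ▸
        inter_mem_nhdsWithin _ (ball_mem_nhds _ (by positivity)), min (min (1 / 2) (δ / 2)) κ₀,
        by positivity, ((min_le_left _ _).trans (min_le_left _ _)).trans_lt (by norm_num), ?_⟩
      rintro y ⟨hyb, hy⟩ hyS v hv hvy
      have hvb := hball δ _ y v ((min_le_left _ _).trans (min_le_right _ _)) (by positivity) hyb hvy
      have hyp : y ≠ p := fun h => hyS (h ▸ hpS)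
      have hd : 0 < |y - p| := abs_pos.2 (sub_ne_zero.2 hyp)
      have h1 : |v - y| ≤ κ₀ * |y - p| := hvy.trans (mul_le_mul (min_le_right _ _)
        (exp_neg_logDistSum_le hpS hyS) (Real.exp_pos _).le hκ₀pos.le)
      have h2 : Real.exp (-(η / (2 * s))) * |y - p| ≤ |v - p| := by
        have h3 := abs_sub_le y v p
        rw [abs_sub_comm y v] at h3
        have : κ₀ * |y - p| = |y - p| - Real.exp (-(η / (2 * s))) * |y - p| := by rw [hκ₀]; ring
        linarith
      have hdv : 0 < |v - p| := lt_of_lt_of_le (by positivity) h2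
      have hvp : v ≠ p := sub_ne_zero.1 (abs_pos.1 hdv)
      have h4 := (hsub ⟨ball_subset_ball (by linarith) hyb, hy, hyp⟩).2
      have h5 := (hsub ⟨hvb, hv, hvp⟩).1
      rw [div_lt_iff₀ (by positivity)] at h4
      rw [lt_div_iff₀ (by positivity)] at h5
      have h6 : Real.exp (-(η / 2)) * |y - p| ^ s ≤ |v - p| ^ s := by
        refine le_trans (le_of_eq ?_) (Real.rpow_le_rpow (by positivity) h2 hs.le)
        rw [Real.mul_rpow (Real.exp_pos _).le hd.le, ← Real.exp_mul]
        congr 2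
        field_simp
      calc Real.exp (-η) * |deriv f y|
          ≤ Real.exp (-η) * (Real.exp (η / 4) * H * |y - p| ^ s) := by gcongr
        _ = Real.exp (-(η / 4)) * H * (Real.exp (-(η / 2)) * |y - p| ^ s) := by
            have : Real.exp (-η) * Real.exp (η / 4) =
                Real.exp (-(η / 4)) * Real.exp (-(η / 2)) := by
              rw [← Real.exp_add, ← Real.exp_add]; congr 1; ring
            linear_combination H * |y - p| ^ s * this
        _ ≤ Real.exp (-(η / 4)) * H * |v - p| ^ s := by gcongr
        _ ≤ _ := h5.le
    · have hd : 0 < |deriv f p| := abs_pos.2 hp0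
      have he1 : Real.exp (-(η / 2)) * |deriv f p| < |deriv f p| :=
        mul_lt_of_lt_one_left hd (Real.exp_lt_one_iff.2 (by linarith))
      have he2 : |deriv f p| < Real.exp (η / 2) * |deriv f p| :=
        lt_mul_of_one_lt_left hd (Real.one_lt_exp_iff.2 (by linarith))
      obtain ⟨δ, hδ, hsub⟩ := Metric.mem_nhdsWithin_iff.1
        ((continuousWithinAt_deriv_of_ne_zero hf hp hp0).abs.eventually (Ioo_mem_nhds he1 he2))
      refine ⟨ball p (δ / 2) ∩ Icc a b, inter_comm (Icc a b) _ ▸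
        inter_mem_nhdsWithin _ (ball_mem_nhds _ (by positivity)), min (1 / 2) (δ / 2),
        by positivity, (min_le_left _ _).trans_lt (by norm_num), ?_⟩
      rintro y ⟨hyb, hy⟩ hyS v hv hvy
      have hvb := hball δ _ y v (min_le_right _ _) (by positivity) hyb hvy
      have h4 := (hsub ⟨ball_subset_ball (by linarith) hyb, hy⟩).2
      have h5 := (hsub ⟨hvb, hv⟩).1
      calc Real.exp (-η) * |deriv f y|
          ≤ Real.exp (-η) * (Real.exp (η / 2) * |deriv f p|) := by gcongr
        _ = Real.exp (-(η / 2)) * |deriv f p| := by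
            rw [← mul_assoc, ← Real.exp_add]; congr 2; ring
        _ ≤ _ := h5.le

theorem exists_preimage_of_le_deriv {g : ℝ → ℝ} (hab : a < b) (hg : MapsTo g (Icc a b) (Icc a b))
    (hd : ∀ x ∈ Icc a b, DifferentiableAt ℝ g x) {y ρ m : ℝ} (hy : y ∈ Icc a b) (hρ : 0 < ρ)
    (hm : 0 < m) (hder : ∀ v ∈ Icc a b, |v - y| ≤ ρ → m ≤ deriv g v)
    (hend : ∀ e, e = a ∨ e = b → |e - y| ≤ ρ → g e = a ∨ g e = b) {u : ℝ} (hu : u ∈ Icc a b)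
    (huy : |u - g y| ≤ m * ρ) : ∃ v ∈ Icc a b, g v = u ∧ |v - y| ≤ ρ := by
  set α := max a (y - ρ) with hα
  set β := min b (y + ρ) with hβ
  have hαβ : α < β := by
    rw [hα, hβ, max_lt_iff, lt_min_iff, lt_min_iff]
    refine ⟨⟨hab, ?_⟩, ?_, ?_⟩ <;> linarith [hy.1, hy.2]
  have hyα : α ≤ y := max_le hy.1 (by linarith)
  have hyβ : y ≤ β := le_min hy.2 (by linarith)
  have hin : ∀ v ∈ Icc α β, v ∈ Icc a b ∧ |v - y| ≤ ρ := by
    intro v hv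
    have h1 := max_le_iff.1 hv.1
    have h2 := le_min_iff.1 hv.2
    refine ⟨⟨h1.1, h2.1⟩, abs_le.2 ⟨?_, ?_⟩⟩ <;> linarith
  have hcont : ContinuousOn g (Icc α β) := fun v hv =>
    (hd v (hin v hv).1).continuousAt.continuousWithinAt
  have hmvt := (convex_Icc α β).mul_sub_le_image_sub_of_le_deriv hcont
    (fun v hv => (hd v (hin v (interior_subset hv)).1).differentiableWithinAt)
    (fun v hv => hder v (hin v (interior_subset hv)).1 (hin v (interior_subset hv)).2)
  have hαm : α ∈ Icc α β := left_mem_Icc.2 hαβ.le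
  have hβm : β ∈ Icc α β := right_mem_Icc.2 hαβ.le
  have hstrict : g α < g β := by
    have := hmvt α hαm β hβm hαβ.le
    have := mul_pos hm (sub_pos.2 hαβ)
    linarith
  have hgα := hg (hin α hαm).1
  have hgβ := hg (hin β hβm).1
  have huy' := abs_le.1 huy
  have hlow : g α ≤ u := by
    rcases le_total a (y - ρ) with h | h
    · have h1 : α = y - ρ := max_eq_right h
      have := hmvt α hαm y ⟨hyα, hyβ⟩ hyα
      have h2 : m * (y - α) = m * ρ := by rw [h1]; ring
      linarith
    · have h1 : α = a := max_eq_left h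
      rcases hend α (Or.inl h1) (hin α hαm).2 with h2 | h2
      · exact h2.trans_le hu.1
      · linarith [hgβ.2]
  have hupp : u ≤ g β := by
    rcases le_total (y + ρ) b with h | h
    · have h1 : β = y + ρ := min_eq_right h
      have := hmvt y ⟨hyα, hyβ⟩ β hβm hyβ
      have h2 : m * (β - y) = m * ρ := by rw [h1]; ring
      linarith
    · have h1 : β = b := min_eq_left h
      rcases hend β (Or.inr h1) (hin β hβm).2 with h2 | h2
      · linarith [hgα.1]
      · exact hu.2.trans_eq h2.symm
  obtain ⟨v, hv, hvu⟩ := intermediate_value_Icc hαβ.le hcont ⟨hlow, hupp⟩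
  exact ⟨v, (hin v hv).1, hvu, (hin v hv).2⟩

theorem exists_preimage_of_le_abs_deriv {g : ℝ → ℝ} (hab : a < b)
    (hg : MapsTo g (Icc a b) (Icc a b)) (hd : ∀ x ∈ Icc a b, DifferentiableAt ℝ g x) {y ρ m : ℝ}
    (hy : y ∈ Icc a b) (hρ : 0 ≤ ρ) (hm : 0 < m)
    (hder : ∀ v ∈ Icc a b, |v - y| ≤ ρ → m ≤ |deriv g v|)
    (hend : ∀ e, e = a ∨ e = b → |e - y| ≤ ρ → g e = a ∨ g e = b) {u : ℝ} (hu : u ∈ Icc a b)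
    (huy : |u - g y| ≤ m * ρ) : ∃ v ∈ Icc a b, g v = u ∧ |v - y| ≤ ρ := by
  rcases hρ.eq_or_lt with rfl | hρ
  · rw [mul_zero] at huy
    exact ⟨y, hy, (sub_eq_zero.1 (abs_nonpos_iff.1 huy)).symm, by simp⟩
  have hV : ∀ v, v ∈ Icc a b ∩ Icc (y - ρ) (y + ρ) ↔ v ∈ Icc a b ∧ |v - y| ≤ ρ := by
    intro v
    rw [mem_inter_iff, abs_le, mem_Icc (a := y - ρ)]
    refine and_congr_right fun _ => ⟨fun h => ⟨?_, ?_⟩, fun h => ⟨?_, ?_⟩⟩ <;> linarith [h.1, h.2]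
  have hsign := hasDerivWithinAt_forall_lt_or_forall_gt_of_forall_ne (f := g) (f' := deriv g)
    ((convex_Icc a b).inter (convex_Icc (y - ρ) (y + ρ))) (m := 0)
    (fun v hv => (hd v hv.1).hasDerivAt.hasDerivWithinAt) fun v hv => by
      have h := (hV v).1 hv
      exact abs_pos.1 (hm.trans_le (hder v h.1 h.2))
  rcases hsign with hneg | hpos
  · have hd' : ∀ x ∈ Icc a b, HasDerivAt (fun x => a + b - g x) (-deriv g x) x := fun x hx =>
      (hd x hx).hasDerivAt.const_sub _
    obtain ⟨v, hv, hvu, hvy⟩ := exists_preimage_of_le_deriv (g := fun x => a + b - g x) hab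
      (fun x hx => ⟨by linarith [(hg hx).2], by linarith [(hg hx).1]⟩)
      (fun x hx => (hd' x hx).differentiableAt) hy hρ hm
      (fun v hv hvy => by
        have h1 := hder v hv hvy
        rwa [abs_of_neg (hneg v ((hV v).2 ⟨hv, hvy⟩)), ← (hd' v hv).deriv] at h1)
      (fun e he hey => by
        rcases hend e he hey with h | h
        · right; simp [h]
        · left; simp [h])
      (u := a + b - u) ⟨by linarith [hu.2], by linarith [hu.1]⟩
      (by rw [abs_sub_comm] at huy; convert huy using 2; ring)
    exact ⟨v, hv, by linarith, hvy⟩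
  · refine exists_preimage_of_le_deriv hab hg hd hy hρ hm (fun v hv hvy => ?_) hend hu huy
    have h1 := hder v hv hvy
    rwa [abs_of_pos (hpos v ((hV v).2 ⟨hv, hvy⟩))] at h1

theorem exists_pullback (hf : IsC3NonflatIntervalMap f a b) {S : Finset ℝ}
    (hS : ∀ x ∈ Icc a b, deriv f x = 0 → x ∈ S)
    (hend : ∀ e, e = a ∨ e = b → e ∉ S → f e = a ∨ f e = b) {η : ℝ} (hη : 0 < η) :
    ∃ κ, 0 < κ ∧ κ < 1 ∧ ∀ y ∈ Icc a b, y ∉ S → ∀ ρ, 0 ≤ ρ →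
      ρ ≤ κ * Real.exp (-logDistSum S y) → ∀ u ∈ Icc a b,
        |u - f y| ≤ Real.exp (-η) * |deriv f y| * ρ → ∃ v ∈ Icc a b, f v = u ∧ |v - y| ≤ ρ := by
  obtain ⟨κ, hκ0, hκ1, hdist⟩ := exists_distortion hf hS hη
  refine ⟨κ, hκ0, hκ1, fun y hy hyS ρ hρ hρκ u hu huy => ?_⟩
  have hd0 : 0 < |deriv f y| := abs_pos.2 fun h => hyS (hS y hy h)
  refine exists_preimage_of_le_abs_deriv hf.lt hf.mapsTo hf.diff hy hρ
    (mul_pos (Real.exp_pos _) hd0) (fun v hv hvy => hdist y hy hyS v hv (hvy.trans hρκ))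
    (fun e he hey => hend e he fun heS => ?_) hu huy
  have h1 := exp_neg_logDistSum_le heS hyS
  have h2 := Real.exp_pos (-logDistSum S y)
  rw [abs_sub_comm] at hey
  nlinarith

end Pullback

section Assembly

theorem exists_pullback_of_hyperbolicTime {X : Type*} [MetricSpace X] {T : X → X}
    {G pen : X → ℝ} {lam r : ℝ} (hlam : 0 ≤ lam) (hr : 0 < r) (hpen : ∀ y, 0 ≤ pen y) (n : ℕ) :
    ∀ x, (∀ k ρ, 0 ≤ ρ → ρ ≤ r * Real.exp (-pen (T^[k] x)) → ∀ u,
        dist u (T (T^[k] x)) ≤ Real.exp (G (T^[k] x)) * ρ → ∃ v, T v = u ∧ dist v (T^[k] x) ≤ ρ) →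
      IsHyperbolicTime T (fun y => G y - pen y) lam x n → ∀ u, dist u (T^[n] x) ≤ r →
      ∃ v, T^[n] v = u ∧
        ∀ j ≤ n, dist (T^[j] v) (T^[j] x) ≤ r * Real.exp (-birkhoffSum T G (n - j) (T^[j] x)) := by
  induction n with
  | zero =>
    intro x _ _ u hu
    refine ⟨u, rfl, fun j hj => ?_⟩
    obtain rfl := Nat.le_zero.1 hj
    simpa using hu
  | succ n ih =>
    intro x hpull hx u hu
    obtain ⟨v', hv', hd⟩ := ih (T x) (fun k => by
      rw [← Function.iterate_succ_apply]; exact hpull (k + 1)) (fun j hj => by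
      have := hx (j + 1) (by omega)
      rwa [Nat.add_sub_add_right, Function.iterate_succ_apply] at this) u
      (by rwa [← Function.iterate_succ_apply])
    have h0 := hd 0 (Nat.zero_le _)
    simp only [Function.iterate_zero, id, Nat.sub_zero] at h0
    have hsum : birkhoffSum T G (n + 1) x = G x + birkhoffSum T G n (T x) :=
      birkhoffSum_succ' T G n x
    have hpensum : pen x ≤ birkhoffSum T G (n + 1) x := by
      have h1 := hx 0 (Nat.succ_pos n)
      simp only [Nat.sub_zero, Function.iterate_zero, id] at h1
      have h2 : birkhoffSum T (fun y => G y - pen y) (n + 1) x =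
          birkhoffSum T G (n + 1) x - birkhoffSum T pen (n + 1) x := by
        simp only [birkhoffSum, Finset.sum_sub_distrib]
      have h3 : pen x ≤ birkhoffSum T pen (n + 1) x := by
        rw [birkhoffSum_succ']
        exact le_add_of_nonneg_right (Finset.sum_nonneg fun _ _ => hpen _)
      have h4 : 0 ≤ lam * ((n + 1 : ℕ) : ℝ) := by positivity
      linarith
    obtain ⟨v, hvT, hvx⟩ := hpull 0 (r * Real.exp (-birkhoffSum T G (n + 1) x)) (by positivity)
      (mul_le_mul_of_nonneg_left (Real.exp_le_exp.2 (neg_le_neg hpensum)) hr.le) v'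
      (h0.trans_eq (by
        simp only [Function.iterate_zero, id]
        rw [mul_left_comm, ← Real.exp_add, hsum]
        congr 2
        ring))
    refine ⟨v, by rw [Function.iterate_succ_apply, hvT, hv'], fun j hj => ?_⟩
    cases j with
    | zero => simpa using hvx
    | succ j =>
      rw [Function.iterate_succ_apply, Function.iterate_succ_apply, hvT, Nat.add_sub_add_right]
      exact hd j (Nat.le_of_succ_le_succ hj)

theorem shadowsAtHyperbolicTimes_of_pullback {X : Type*} [MetricSpace X] {T : X → X}
    {G pen : X → ℝ} {lam r : ℝ} (hlam : 0 ≤ lam) (hr : 0 < r) (hpen : ∀ y, 0 ≤ pen y) {x : X}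
    (hpull : ∀ k ρ, 0 ≤ ρ → ρ ≤ r * Real.exp (-pen (T^[k] x)) → ∀ u,
      dist u (T (T^[k] x)) ≤ Real.exp (G (T^[k] x)) * ρ → ∃ v, T v = u ∧ dist v (T^[k] x) ≤ ρ) :
    ShadowsAtHyperbolicTimes T (fun y => G y - pen y) lam r x := by
  intro n hn u hu
  obtain ⟨v, hv, hd⟩ := exists_pullback_of_hyperbolicTime hlam hr hpen n x hpull hn u hu
  refine ⟨v, hv, fun j hj => (hd j hj).trans
    (mul_le_mul_of_nonneg_left (Real.exp_le_exp.2 (neg_le_neg ?_)) hr.le)⟩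
  rcases hj.eq_or_lt with rfl | hj
  · simp
  · exact (hn j hj).trans (Finset.sum_le_sum fun i _ => sub_le_self _ (hpen _))

theorem tendsto_integral_max_sub {X : Type*} [MeasurableSpace X] {ν : Measure X} {W : X → ℝ}
    (hW : ∀ x, 0 ≤ W x) (h_int : Integrable W ν) :
    Tendsto (fun n : ℕ => ∫ x, max 0 (W x - n) ∂ν) atTop (𝓝 0) := by
  have h := tendsto_integral_of_dominated_convergence (μ := ν)
    (F := fun (n : ℕ) x => max 0 (W x - n)) (f := fun _ => 0) W
    (fun n => (aestronglyMeasurable_const.sup (h_int.1.sub aestronglyMeasurable_const))) h_int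
    (fun n => Eventually.of_forall fun x => by
      rw [Real.norm_of_nonneg (le_max_left _ _)]
      exact max_le (hW x) (sub_le_self _ (Nat.cast_nonneg n)))
    (Eventually.of_forall fun x => by
      obtain ⟨N, hN⟩ := exists_nat_ge (W x)
      refine tendsto_const_nhds.congr' ?_
      filter_upwards [eventually_ge_atTop N] with n hn
      have : (N : ℝ) ≤ n := by exact_mod_cast hn
      exact (max_eq_left (by linarith)).symm)
  simpa using h

variable {f : ℝ → ℝ} {a b : ℝ}

theorem exists_shadowing_of_lyapunov_pos (hf : IsC3NonflatIntervalMap f a b)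
    (hex : TopExact f (Icc a b)) {ν : Measure (Icc a b)} [IsProbabilityMeasure ν]
    (hT : MeasurePreserving (hf.mapsTo.restrict f _ _) ν ν)
    (hpos : 0 < ∫ x : Icc a b, Real.log |deriv f x| ∂ν) :
    ∃ (Ψ : Icc a b → ℝ) (A r lam : ℝ) (M : ℕ) (far : Icc a b → Icc a b),
      (∀ x, Ψ x ≤ A) ∧ Integrable Ψ ν ∧ 0 ≤ r ∧ 0 < lam ∧ 4 * lam ≤ ∫ x, Ψ x ∂ν ∧
      (∀ᵐ x ∂ν, ∀ k, ShadowsAtHyperbolicTimes (hf.mapsTo.restrict f _ _) Ψ lam r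
        ((hf.mapsTo.restrict f _ _)^[k] x)) ∧ 1 ≤ M ∧
      (∀ y z, ∃ v, dist v y ≤ r ∧ (hf.mapsTo.restrict f _ _)^[M] v = z) ∧
      ∀ y, 2 * r < dist y (far y) := by
  classical
  set T := hf.mapsTo.restrict f _ _ with hTdef
  have hab := hf.lt
  set χ := ∫ x : Icc a b, Real.log |deriv f x| ∂ν with hχ
  have h_int : Integrable (fun x : Icc a b => Real.log |deriv f x|) ν := by
    by_contra h
    rw [hχ, integral_undef h] at hpos
    exact lt_irrefl _ hpos
  obtain ⟨S, htame, hcrit, hend⟩ := exists_singular_set hf hex hT h_int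
  obtain ⟨κ, hκ0, hκ1, hpull⟩ := exists_pullback hf hcrit hend (η := χ / 4) (by positivity)
  obtain ⟨L, hL1, hL⟩ := exists_abs_deriv_le hf
  have hWint : Integrable (fun x : Icc a b => logDistSum S x) ν :=
    integrable_finsetSum S fun p hp => (htame p hp).2
  have hlim1 := tendsto_integral_max_sub (fun x : Icc a b => logDistSum_nonneg S x) hWint
  have hlim2 : Tendsto (fun n : ℕ => κ * Real.exp (-(n : ℝ))) atTop (𝓝 0) := by
    simpa using (Real.tendsto_exp_neg_atTop_nhds_zero.comp
      tendsto_natCast_atTop_atTop).const_mul κ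
  obtain ⟨N, hN1, hN2⟩ := ((hlim1.eventually (gt_mem_nhds (show 0 < χ / 4 by positivity))).and
    (hlim2.eventually (gt_mem_nhds (show 0 < (b - a) / 8 by linarith)))).exists
  set r := κ * Real.exp (-(N : ℝ)) with hr
  have hr0 : 0 < r := by positivity
  set pen : Icc a b → ℝ := fun x => max 0 (logDistSum S x - N) with hpendef
  set G : Icc a b → ℝ := fun x => Real.log |deriv f x| - χ / 4 with hG
  have hpen0 : ∀ y, 0 ≤ pen y := fun y => le_max_left _ _
  have hpenint : Integrable pen ν := by
    refine hWint.mono' (aestronglyMeasurable_const.sup (hWint.1.sub aestronglyMeasurable_const))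
      (Eventually.of_forall fun x => ?_)
    rw [Real.norm_of_nonneg (hpen0 x)]
    exact max_le (logDistSum_nonneg S x) (sub_le_self _ (Nat.cast_nonneg N))
  have hGint : Integrable G ν := h_int.sub (integrable_const _)
  obtain ⟨M, hM1, hM⟩ := hex.exists_uniform hf.mapsTo hr0
  have hgood : ∀ᵐ x : Icc a b ∂ν, ∀ k, ((T^[k] x : Icc a b) : ℝ) ∉ S := by
    have h1 : ∀ᵐ x : Icc a b ∂ν, (x : ℝ) ∉ S := by
      have : ∀ᵐ x : Icc a b ∂ν, ∀ p ∈ (S : Set ℝ), (x : ℝ) ≠ p := by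
        rw [ae_ball_iff S.countable_toSet]
        exact fun p hp => (htame p hp).1
      filter_upwards [this] with x hx hxS using hx x hxS rfl
    exact ae_all_iff.2 fun k => (hT.iterate k).quasiMeasurePreserving.ae h1
  refine ⟨fun y => G y - pen y, Real.log L, r, χ / 8, M,
    fun y => if (y : ℝ) ≤ (a + b) / 2 then ⟨b, right_mem_Icc.2 hab.le⟩
      else ⟨a, left_mem_Icc.2 hab.le⟩, fun x => ?_, hGint.sub hpenint, hr0.le, by positivity, ?_, ?_,
    hM1, hM, fun y => ?_⟩
  · have h1 : Real.log |deriv f x| ≤ Real.log L := by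
      by_cases h0 : deriv f x = 0
      · rw [h0, abs_zero, Real.log_zero]
        exact Real.log_nonneg hL1
      · exact Real.log_le_log (abs_pos.2 h0) (hL x x.2)
    have := hpen0 x
    simp only [hG]
    linarith
  · rw [integral_sub hGint hpenint, hG, integral_sub h_int (integrable_const _), integral_const]
    simp only [probReal_univ, one_smul]
    linarith
  · filter_upwards [hgood] with x hx k
    refine shadowsAtHyperbolicTimes_of_pullback (lam := χ / 8) (by positivity) hr0 hpen0
      fun j ρ hρ0 hρ u hu => ?_
    rw [← Function.iterate_add_apply] at hρ hu ⊢
    set y := T^[j + k] x with hy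
    have hyS : (y : ℝ) ∉ S := hx (j + k)
    have hd0 : 0 < |deriv f y| := abs_pos.2 fun h => hyS (hcrit y y.2 h)
    have h1 : ρ ≤ κ * Real.exp (-logDistSum S y) := by
      refine hρ.trans ?_
      rw [hr, mul_assoc, ← Real.exp_add]
      refine mul_le_mul_of_nonneg_left (Real.exp_le_exp.2 ?_) hκ0.le
      have : logDistSum S y - N ≤ pen y := le_max_right _ _
      linarith
    have h2 : Real.exp (G y) = Real.exp (-(χ / 4)) * |deriv f y| := by
      simp only [hG]
      rw [sub_eq_neg_add, Real.exp_add, Real.exp_log hd0]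
    obtain ⟨v, hv, hvu, hvy⟩ := hpull y y.2 hyS ρ hρ0 h1 u u.2 (by rw [← h2]; exact hu)
    exact ⟨⟨v, hv⟩, Subtype.ext hvu, hvy⟩
  · beta_reduce
    split_ifs with h
    · rw [Subtype.dist_eq, Real.dist_eq, abs_sub_comm]
      exact lt_of_lt_of_le (by linarith) (le_abs_self _)
    · rw [Subtype.dist_eq, Real.dist_eq]
      exact lt_of_lt_of_le (by linarith) (le_abs_self _)

end Assembly

/-- **Lemma (positive Lyapunov exponents of equilibrium states imply hyperbolicity).**
If every equilibrium state of `f` for the Hölder potential `φ` has strictly positive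
Lyapunov exponent, then `φ` is hyperbolic for `f`. -/
theorem positive_lyapunov_implies_hyperbolic
    (a b : ℝ) (f φ : ℝ → ℝ)
    (hf : IsC3NonflatIntervalMap f a b)
    (hex : TopExact f (Icc a b))
    (hφ : HolderOn φ (Icc a b))
    (hlyap : ∀ μ : Measure ℝ, IsEquilibriumState f (Icc a b) φ μ →
      0 < ∫ x, Real.log |deriv f x| ∂μ) :
    HyperbolicPotential f (Icc a b) φ := by
  obtain ⟨L, hL1, hL⟩ := exists_abs_deriv_le hf
  refine hyperbolicPotential_of_shadowing hf.lt hf.mapsTo hL1 (abs_sub_le_of_deriv_le hf hL) hφ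
    fun ν _ hT heq => exists_shadowing_of_lyapunov_pos hf hex hT ?_
  rw [← integral_map_val ν fun x => Real.log |deriv f x|]
  exact hlyap _ heq

end
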